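/- Let f : ℂ → ℂ be a nonconstant entire function and let k, n be positive integers with n ≥ k + 2. If f^n and (f^n)^{(k)} share the value 1 IM, then f^n = (f^n)^{(k)} identically; that is, f(z) = c·e^{(λ/n)z} for some c, λ ∈ ℂ \ {0} with λ^k = 1. (Zhang–Yang; the paper's Theorem 2.F.) -/

import Mathlib

section

open Metric Set Filter Topology

/-- Evaluation at a point of the monic polynomial with prescribed roots. -/
noncomputable def rootProd (s : Multiset ℂ) (z : ℂ) : ℂ := (s.map fun a => z - a).prod

@[simp] lemma rootProd_zero (z : ℂ) : rootProd 0 z = 1 := by simp [rootProd]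

@[simp] lemma rootProd_cons (a : ℂ) (s : Multiset ℂ) (z : ℂ) :
    rootProd (a ::ₘ s) z = (z - a) * rootProd s z := by simp [rootProd]

lemma differentiable_rootProd (s : Multiset ℂ) : Differentiable ℂ (rootProd s) := by
  induction s using Multiset.induction_on with
  | empty =>
    rw [show rootProd 0 = fun _ => 1 from funext rootProd_zero]
    exact differentiable_const _
  | cons a s ih =>
    rw [show rootProd (a ::ₘ s) = fun z => (z - a) * rootProd s z from funext (rootProd_cons a s)]
    fun_prop

lemma norm_le_of_forall_sphere {g : ℂ → ℂ} (hg : Differentiable ℂ g) {r M : ℝ}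
    (h : ∀ z, ‖z‖ = r → ‖g z‖ ≤ M) {z : ℂ} (hz : ‖z‖ ≤ r) : ‖g z‖ ≤ M := by
  rcases eq_or_ne r 0 with rfl | hr
  · exact h z (le_antisymm hz (norm_nonneg z))
  · refine Complex.norm_le_of_forall_mem_frontier_norm_le (U := ball 0 r) isBounded_ball
      hg.diffContOnCl (fun w hw => h w ?_) ?_
    · rw [frontier_ball _ hr] at hw
      simpa using hw
    · rw [closure_ball _ hr]
      simpa using hz

lemma norm_rootProd_mul_pow_le {ρ R : ℝ} (hR : 0 < R) (hρ : R < ρ) {M : ℝ} (s : Multiset ℂ) :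
    ∀ h : ℂ → ℂ, Differentiable ℂ h → (∀ a ∈ s, ‖a‖ ≤ R) →
      (∀ z, ‖z‖ ≤ ρ → ‖rootProd s z * h z‖ ≤ M) →
      ‖rootProd s 0 * h 0‖ * (ρ / R) ^ s.card ≤ M := by
  induction s using Multiset.induction_on with
  | empty =>
    intro h _ _ hM
    simpa using hM 0 (by simp; linarith)
  | cons a s ih =>
    intro h hh hs hM
    have hρ0 : 0 < ρ := hR.trans hρ
    have key := ih (fun z => h z * ((ρ ^ 2 - (starRingEnd ℂ) a * z) / ρ)) (by fun_prop)
      (fun b hb => hs b (Multiset.mem_cons_of_mem hb)) (by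
        intro z hz
        refine norm_le_of_forall_sphere
          (g := fun z => rootProd s z * (h z * ((ρ ^ 2 - (starRingEnd ℂ) a * z) / ρ)))
          ((differentiable_rootProd s).mul (by fun_prop)) (fun w hw => ?_) hz
        have h1 : ‖((ρ : ℂ) ^ 2 - (starRingEnd ℂ) a * w) / ρ‖ = ‖w - a‖ := by
          have : (ρ : ℂ) ^ 2 - (starRingEnd ℂ) a * w = w * (starRingEnd ℂ) (w - a) := by
            rw [map_sub, mul_sub, Complex.mul_conj, Complex.normSq_eq_norm_sq, hw]
            push_cast; ring
          rw [this, norm_div, norm_mul, RCLike.norm_conj, hw, Complex.norm_real,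
            Real.norm_of_nonneg hρ0.le]
          field_simp
        have := hM w hw.le
        rw [rootProd_cons] at this
        calc _ = ‖(w - a) * rootProd s w * h w‖ := by
              simp only [norm_mul, h1]; ring
          _ ≤ M := this)
    have ha := hs a (Multiset.mem_cons_self a s)
    have e : ‖(ρ : ℂ) ^ 2 / ρ‖ = ρ := by
      rw [sq, mul_div_assoc, div_self (by exact_mod_cast hρ0.ne'), mul_one, Complex.norm_real,
        Real.norm_of_nonneg hρ0.le]
    rw [mul_zero, sub_zero, norm_mul (rootProd s 0), norm_mul (h 0), e] at key
    refine le_trans ?_ key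
    rw [rootProd_cons, Multiset.card_cons, pow_succ, norm_mul, norm_mul, zero_sub, norm_neg]
    have : ‖a‖ * (ρ / R) ≤ ρ := by
      rw [← mul_div_assoc, div_le_iff₀ hR]; nlinarith
    have hnn : 0 ≤ ‖rootProd s 0‖ * ‖h 0‖ * (ρ / R) ^ s.card := by positivity
    calc ‖a‖ * ‖rootProd s 0‖ * ‖h 0‖ * ((ρ / R) ^ s.card * (ρ / R))
        = ‖rootProd s 0‖ * ‖h 0‖ * (ρ / R) ^ s.card * (‖a‖ * (ρ / R)) := by ring
      _ ≤ ‖rootProd s 0‖ * ‖h 0‖ * (ρ / R) ^ s.card * ρ := by gcongr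
      _ = _ := by ring

lemma exists_eq_sub_mul {h : ℂ → ℂ} (hh : Differentiable ℂ h) {a : ℂ} (ha : h a = 0) :
    ∃ q : ℂ → ℂ, Differentiable ℂ q ∧ ∀ z, h z = (z - a) * q z := by
  refine ⟨dslope h a, ?_, fun z => ?_⟩
  · exact differentiableOn_univ.1
      ((Complex.differentiableOn_dslope Filter.univ_mem).2 hh.differentiableOn)
  · have := sub_smul_dslope h a z
    rw [ha, sub_zero, smul_eq_mul] at this
    exact this.symm

/-- Splitting off the zeros of an entire function in a disc, with a bound on their number. -/
lemma exists_zero_free_factor {g : ℂ → ℂ} (hg : Differentiable ℂ g) (hg0 : g 0 ≠ 0)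
    {ρ R M : ℝ} (hR : 0 < R) (hρ : R < ρ) (hM : ∀ z, ‖z‖ ≤ ρ → ‖g z‖ ≤ M) :
    ∃ (s : Multiset ℂ) (h : ℂ → ℂ), Differentiable ℂ h ∧ (∀ a ∈ s, ‖a‖ ≤ R) ∧
      (∀ z, g z = rootProd s z * h z) ∧ (∀ z, ‖z‖ ≤ R → h z ≠ 0) ∧
      ‖g 0‖ * (ρ / R) ^ s.card ≤ M := by
  classical
  let P : ℕ → Prop := fun n => ∃ (s : Multiset ℂ) (h : ℂ → ℂ), s.card = n ∧ Differentiable ℂ h ∧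
    (∀ a ∈ s, ‖a‖ ≤ R) ∧ ∀ z, g z = rootProd s z * h z
  have hbd : ∀ n, P n → ‖g 0‖ * (ρ / R) ^ n ≤ M := by
    rintro n ⟨s, h, rfl, hh, hs, hgs⟩
    rw [hgs 0]
    exact norm_rootProd_mul_pow_le hR hρ s h hh hs fun z hz => by rw [← hgs z]; exact hM z hz
  have hP0 : P 0 := ⟨0, g, by simp, hg, by simp, by simp⟩
  have hlt : 1 < ρ / R := by rwa [one_lt_div hR]
  obtain ⟨N, hN⟩ := pow_unbounded_of_one_lt (M / ‖g 0‖) hlt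
  have hle : ∀ n, P n → n ≤ N := by
    intro n hn
    by_contra hcon
    have h1 := hbd n hn
    have h2 : (ρ / R) ^ N ≤ (ρ / R) ^ n := pow_le_pow_right₀ hlt.le (by omega)
    rw [div_lt_iff₀ (norm_pos_iff.2 hg0)] at hN
    nlinarith [norm_pos_iff.2 hg0]
  obtain ⟨s, h, hcard, hh, hs, hgs⟩ := Nat.findGreatest_spec (P := P) (Nat.zero_le N) hP0
  refine ⟨s, h, hh, hs, hgs, fun a haR ha => ?_, ?_⟩
  · obtain ⟨q, hq, hqe⟩ := exists_eq_sub_mul hh ha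
    have hP : P (s.card + 1) := ⟨a ::ₘ s, q, by simp, hq, by
      intro b hb
      rcases Multiset.mem_cons.1 hb with rfl | hb
      · exact haR
      · exact hs b hb, fun z => by rw [hgs z, hqe z, rootProd_cons]; ring⟩
    have := Nat.le_findGreatest (hle _ hP) hP
    omega
  · exact hbd _ ⟨s, h, rfl, hh, hs, hgs⟩

lemma exists_hasDerivAt_exp_eq {h : ℂ → ℂ} (hh : Differentiable ℂ h) {U : Set ℂ} (hU : IsOpen U)
    (hUc : IsPreconnected U) {c : ℂ} (hc : c ∈ U) (hne : ∀ z ∈ U, h z ≠ 0)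
    (hex : Complex.IsExactOn (fun z => deriv h z / h z) U) :
    ∃ H : ℂ → ℂ, ∀ z ∈ U, HasDerivAt H (deriv h z / h z) z ∧ h z = Complex.exp (H z) := by
  obtain ⟨H, hH0, hH⟩ := hex.with_val_at c (Complex.log (h c))
  refine ⟨H, fun z hz => ⟨hH z hz, ?_⟩⟩
  have hd : ∀ w ∈ U, HasDerivAt (fun w => h w * Complex.exp (-H w)) 0 w := by
    intro w hw
    have := (hh w).hasDerivAt.mul (hH w hw).neg.cexp
    have e : h w * (deriv h w / h w) = deriv h w := mul_div_cancel₀ _ (hne w hw)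
    exact this.congr_deriv (by linear_combination -Complex.exp (-H w) * e)
  have hconst := hU.is_const_of_deriv_eq_zero hUc
    (fun w hw => (hd w hw).differentiableAt.differentiableWithinAt)
    (fun w hw => (hd w hw).deriv) hz hc
  rw [hH0, Complex.exp_neg, Complex.exp_neg, Complex.exp_log (hne c hc),
    mul_inv_cancel₀ (hne c hc)] at hconst
  exact (mul_inv_eq_one₀ (Complex.exp_ne_zero _)).1 hconst

lemma norm_rootProd_le {s : Multiset ℂ} {z : ℂ} {A : ℝ} (h : ∀ a ∈ s, ‖z - a‖ ≤ A) :
    ‖rootProd s z‖ ≤ A ^ s.card := by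
  induction s using Multiset.induction_on with
  | empty => simp
  | cons a s ih =>
    rw [rootProd_cons, norm_mul, Multiset.card_cons, pow_succ']
    have h1 := h a (Multiset.mem_cons_self a s)
    exact mul_le_mul h1 (ih fun b hb => h b (Multiset.mem_cons_of_mem hb)) (norm_nonneg _)
      ((norm_nonneg _).trans h1)

lemma le_norm_rootProd {s : Multiset ℂ} {z : ℂ} {A : ℝ} (hA : 0 ≤ A) (h : ∀ a ∈ s, A ≤ ‖z - a‖) :
    A ^ s.card ≤ ‖rootProd s z‖ := by
  induction s using Multiset.induction_on with
  | empty => simp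
  | cons a s ih =>
    rw [rootProd_cons, norm_mul, Multiset.card_cons, pow_succ']
    exact mul_le_mul (h a (Multiset.mem_cons_self a s))
      (ih fun b hb => h b (Multiset.mem_cons_of_mem hb)) (pow_nonneg hA _) (norm_nonneg _)

lemma norm_deriv_rootProd_le {s : Multiset ℂ} {z : ℂ} {A : ℝ} (hA : 0 < A)
    (h : ∀ a ∈ s, A ≤ ‖z - a‖) :
    ‖deriv (rootProd s) z‖ ≤ s.card / A * ‖rootProd s z‖ := by
  induction s using Multiset.induction_on with
  | empty =>
    rw [show rootProd 0 = fun _ => 1 from funext rootProd_zero]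
    simp
  | cons a s ih =>
    have hd : deriv (rootProd (a ::ₘ s)) z = rootProd s z + (z - a) * deriv (rootProd s) z := by
      rw [show rootProd (a ::ₘ s) = fun z => (z - a) * rootProd s z from
        funext (rootProd_cons a s)]
      have := ((hasDerivAt_id z).sub_const a).mul (differentiable_rootProd s z).hasDerivAt
      refine this.deriv.trans ?_
      simp
    have h1 := h a (Multiset.mem_cons_self a s)
    have h2 := ih fun b hb => h b (Multiset.mem_cons_of_mem hb)
    have h3 : 1 ≤ 1 / A * ‖z - a‖ := by
      rw [one_div, inv_mul_eq_div, le_div_iff₀ hA]; linarith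
    rw [hd, rootProd_cons, Multiset.card_cons]
    push_cast
    calc _ ≤ ‖rootProd s z‖ + ‖z - a‖ * ‖deriv (rootProd s) z‖ := by
          rw [← norm_mul]; exact norm_add_le _ _
      _ ≤ 1 / A * ‖z - a‖ * ‖rootProd s z‖ + ‖z - a‖ * (s.card / A * ‖rootProd s z‖) := by
          gcongr
          exact le_mul_of_one_le_left (norm_nonneg _) h3
      _ = _ := by rw [norm_mul]; ring

/-- Bounds for a zero-free function `h = exp H` in terms of an upper bound for its modulus. -/
lemma zero_free_bounds {h : ℂ → ℂ} (hh : Differentiable ℂ h) {r δ R : ℝ} (hr : 0 ≤ r)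
    (hδ : 0 < δ) (hR : R = r + δ) (hne : ∀ z, ‖z‖ ≤ R → h z ≠ 0) {M₁ M₂ : ℝ} (hM : 0 < M₁ + M₂)
    (hup : ∀ z, ‖z‖ ≤ R → ‖h z‖ ≤ Real.exp M₁) (hlow : Real.exp (-M₂) ≤ ‖h 0‖)
    {z : ℂ} (hz : ‖z‖ ≤ r) :
    ‖deriv h z‖ ≤ 8 * (M₁ + M₂) * R / δ ^ 2 * ‖h z‖ ∧
      Real.exp (-(M₂ + 2 * (M₁ + M₂) * R / δ)) ≤ ‖h z‖ := by
  have hRpos : 0 < R := by linarith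
  have hdiff : DifferentiableOn ℂ (fun z => deriv h z / h z) (ball 0 R) := fun w hw =>
    ((hh.deriv w).div (hh w) (hne w (by simpa using (mem_ball.1 hw).le))).differentiableWithinAt
  obtain ⟨H, hH⟩ := exists_hasDerivAt_exp_eq hh isOpen_ball
    (convex_ball (0 : ℂ) R).isPreconnected (mem_ball_self hRpos)
    (fun w hw => hne w (by simpa using (mem_ball.1 hw).le)) hdiff.isExactOn_ball
  have hn : ∀ w ∈ ball (0 : ℂ) R, ‖h w‖ = Real.exp (H w).re := fun w hw => by
    rw [(hH w hw).2, Complex.norm_exp]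
  have h0 : -M₂ ≤ (H 0).re := by
    rwa [hn 0 (mem_ball_self hRpos), Real.exp_le_exp] at hlow
  have hre : ∀ w ∈ ball (0 : ℂ) R, (H w).re ≤ M₁ := fun w hw => by
    have := hup w (by simpa using (mem_ball.1 hw).le)
    rwa [hn w hw, Real.exp_le_exp] at this
  have hbc : ∀ w, ‖w‖ < R → ‖H w - H 0‖ ≤ 2 * (M₁ + M₂) * ‖w‖ / (R - ‖w‖) := by
    intro w hw
    refine Complex.borelCaratheodory_zero (f := fun w => H w - H 0) hM
      (fun v hv => ((hH v hv).1.sub_const _).differentiableAt.differentiableWithinAt) ?_ hRpos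
      (by simpa using hw) (by simp)
    intro v hv
    have := hre v hv
    simp only [Set.mem_ofPred_eq, Complex.sub_re]
    linarith
  have hzR : z ∈ ball (0 : ℂ) R := by simp; linarith
  constructor
  · have hder : ‖deriv H z‖ ≤ (2 * (M₁ + M₂) * R / (δ / 2)) / (δ / 2) := by
      have hsub : closedBall z (δ / 2) ⊆ ball (0 : ℂ) R := by
        intro w hw
        have := norm_le_norm_add_norm_sub z w
        rw [mem_closedBall, dist_eq_norm, ← norm_neg, neg_sub] at hw
        simp; linarith
      have := Complex.norm_deriv_le_of_forall_mem_sphere_norm_le (f := fun w => H w - H 0) (c := z)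
        (R := δ / 2) (C := 2 * (M₁ + M₂) * R / (δ / 2)) (by positivity) ?_ ?_
      · simpa using this
      · refine DifferentiableOn.diffContOnCl fun w hw => ?_
        rw [closure_ball z (by positivity)] at hw
        exact ((hH w (hsub hw)).1.sub_const _).differentiableAt.differentiableWithinAt
      · intro w hw
        have h1 := norm_le_norm_add_norm_sub z w
        have h2 : ‖z - w‖ = δ / 2 := by
          rw [mem_sphere, dist_eq_norm] at hw
          rw [← hw, ← norm_neg, neg_sub]
        have hw' : ‖w‖ ≤ r + δ / 2 := by linarith
        refine (hbc w (by linarith)).trans ?_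
        gcongr <;> linarith
    have e : deriv h z = deriv H z * h z := by
      rw [(hH z hzR).1.deriv, div_mul_cancel₀ _ (hne z (by linarith))]
    rw [e, norm_mul]
    gcongr
    refine hder.trans (le_of_eq ?_)
    field_simp
    ring
  · rw [hn z hzR, Real.exp_le_exp]
    have h1 := hbc z (by linarith)
    have h2 : 2 * (M₁ + M₂) * ‖z‖ / (R - ‖z‖) ≤ 2 * (M₁ + M₂) * R / δ := by
      gcongr <;> linarith
    have h3 := (abs_le.1 (Complex.abs_re_le_norm (H z - H 0))).1
    rw [Complex.sub_re] at h3
    linarith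

lemma exp_neg_div_le_pow {η : ℝ} (hη : 0 < η) (n : ℕ) : Real.exp (-(n / η)) ≤ η ^ n := by
  have h1 : 1 - η⁻¹ ≤ Real.log η := Real.one_sub_inv_le_log_of_pos hη
  rw [← Real.exp_log (pow_pos hη n), Real.exp_le_exp, Real.log_pow, div_eq_mul_inv]
  have : (0 : ℝ) ≤ n := Nat.cast_nonneg n
  nlinarith

/-- Outside thin annuli around its zeros, an entire function has controlled logarithmic derivative
and lower bound, in terms of an upper bound on a slightly larger disc. -/
lemma exists_logDeriv_bound {g : ℂ → ℂ} (hg : Differentiable ℂ g) (hg0 : g 0 ≠ 0) :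
    ∃ C : ℝ, 1 ≤ C ∧ ∀ V B r : ℝ, 1 ≤ V → 1 ≤ B → 0 ≤ r → r + 2 / V ≤ V →
      (∀ z, ‖z‖ ≤ r + 2 / V → ‖g z‖ ≤ Real.exp B) →
      ∃ s : Finset ℝ, (s.card : ℝ) ≤ C * V ^ 6 * B ∧ ∀ η : ℝ, 0 < η → η ≤ 1 →
        ∀ z, ‖z‖ ≤ r → (∀ t ∈ s, η ≤ |‖z‖ - t|) →
          ‖deriv g z‖ ≤ C * V ^ 6 * B / η * ‖g z‖ ∧ Real.exp (-(C * V ^ 6 * B / η)) ≤ ‖g z‖ := by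
  classical
  set Λ : ℝ := |Real.log ‖g 0‖| with hΛ
  have hΛ0 : 0 ≤ Λ := abs_nonneg _
  refine ⟨25 * (1 + Λ), by linarith, fun V B r hV hB hr hrV hbd => ?_⟩
  have hV0 : 0 < V := by linarith
  set δ : ℝ := 1 / V with hδ
  have hδ0 : 0 < δ := by positivity
  have hδV : δ * V = 1 := by rw [hδ]; field_simp
  have h2δ : 2 / V = 2 * δ := by rw [hδ]; ring
  rw [h2δ] at hrV hbd
  have hg0' : 0 < ‖g 0‖ := norm_pos_iff.2 hg0
  obtain ⟨s, h, hh, hs, hgs, hne, hcard⟩ := exists_zero_free_factor hg hg0 (R := r + δ)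
    (ρ := r + 2 * δ) (by linarith) (by linarith) hbd
  set n : ℝ := (s.card : ℝ) with hn
  have hn0 : 0 ≤ n := Nat.cast_nonneg _
  have hnle : n ≤ (1 + Λ) * V ^ 2 * B := by
    have h1 : Real.log (‖g 0‖ * ((r + 2 * δ) / (r + δ)) ^ s.card) ≤ B := by
      rw [← Real.log_exp B]
      exact Real.log_le_log (by positivity) hcard
    rw [Real.log_mul hg0'.ne' (by positivity), Real.log_pow] at h1
    have h2 := Real.one_sub_inv_le_log_of_pos (x := (r + 2 * δ) / (r + δ)) (by positivity)
    have h3 : δ / V ≤ 1 - ((r + 2 * δ) / (r + δ))⁻¹ := by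
      have : 1 - ((r + 2 * δ) / (r + δ))⁻¹ = δ / (r + 2 * δ) := by
        field_simp
        ring
      rw [this]
      gcongr
    have h4 : n * (δ / V) ≤ (1 + Λ) * B := by
      have h5 : n * (δ / V) ≤ n * Real.log ((r + 2 * δ) / (r + δ)) := by
        gcongr
        linarith
      have h6 := neg_abs_le (Real.log ‖g 0‖)
      nlinarith
    have h7 : n * (δ / V) = n / V ^ 2 := by
      rw [hδ]
      field_simp
    rw [h7, div_le_iff₀ (by positivity)] at h4
    linarith
  have hpowV : Real.exp (-(n * V)) ≤ δ ^ s.card := by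
    have := exp_neg_div_le_pow hδ0 s.card
    rwa [show (s.card : ℝ) / δ = n * V by rw [hδ, div_div_eq_mul_div, div_one]] at this
  have hup : ∀ z, ‖z‖ ≤ r + δ → ‖h z‖ ≤ Real.exp (B + n * V) := by
    intro z hz
    refine norm_le_of_forall_sphere hh (r := r + 2 * δ) (fun w hw => ?_) (by linarith)
    have h1 : δ ^ s.card ≤ ‖rootProd s w‖ := le_norm_rootProd hδ0.le fun a ha => by
      have h2 := norm_sub_norm_le w a
      have h3 := hs a ha
      linarith
    have h2 := hbd w hw.le
    rw [hgs w, norm_mul] at h2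
    have h3 : Real.exp (-(n * V)) * ‖h w‖ ≤ Real.exp B :=
      (mul_le_mul_of_nonneg_right (hpowV.trans h1) (norm_nonneg _)).trans h2
    rw [Real.exp_neg, inv_mul_le_iff₀ (Real.exp_pos _), mul_comm, ← Real.exp_add] at h3
    exact h3
  have hlow : Real.exp (-(Λ + n * V)) ≤ ‖h 0‖ := by
    have h1 : ‖rootProd s 0‖ ≤ V ^ s.card := norm_rootProd_le fun a ha => by
      have := hs a ha
      rw [zero_sub, norm_neg]
      linarith
    have h2 : V ^ s.card ≤ Real.exp (n * V) := by
      rw [hn, Real.exp_nat_mul]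
      have := Real.add_one_le_exp V
      gcongr
      linarith
    have h3 : Real.exp (-Λ) ≤ ‖g 0‖ := by
      rw [← Real.exp_log hg0', Real.exp_le_exp]
      exact neg_abs_le _
    rw [hgs 0, norm_mul] at h3
    have h4 : Real.exp (-Λ) ≤ Real.exp (n * V) * ‖h 0‖ :=
      h3.trans (mul_le_mul_of_nonneg_right (h1.trans h2) (norm_nonneg _))
    rw [neg_add, Real.exp_add, Real.exp_neg (n * V), mul_comm, inv_mul_le_iff₀ (Real.exp_pos _)]
    exact h4
  have hVB : (1 + Λ) * B ≤ (1 + Λ) * V ^ 3 * B := by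
    gcongr
    exact le_mul_of_one_le_right (by linarith) (one_le_pow₀ hV)
  have hnV : n * V ≤ (1 + Λ) * V ^ 3 * B := by
    calc n * V ≤ (1 + Λ) * V ^ 2 * B * V := by gcongr
      _ = _ := by ring
  have hsum : (B + n * V) + (Λ + n * V) ≤ 3 * ((1 + Λ) * V ^ 3 * B) := by nlinarith
  set E : ℝ := (1 + Λ) * V ^ 6 * B with hE
  have hE3 : (1 + Λ) * V ^ 3 * B ≤ E := by
    rw [hE]; gcongr; norm_num
  have hE5 : (1 + Λ) * V ^ 5 * B ≤ E := by
    rw [hE]; gcongr; norm_num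
  have hE2 : (1 + Λ) * V ^ 2 * B ≤ E := by
    rw [hE]; gcongr; norm_num
  have hE0 : 0 ≤ E := by positivity
  have hEe : 25 * (1 + Λ) * V ^ 6 * B = 25 * E := by rw [hE]; ring
  rw [hEe]
  refine ⟨(s.map (fun a => ‖a‖)).toFinset, ?_, fun η hη hη1 z hz hzs => ?_⟩
  · have h1 : ((s.map (fun a => ‖a‖)).toFinset.card : ℝ) ≤ n := by
      rw [hn]
      exact_mod_cast (Multiset.toFinset_card_le _).trans (by simp)
    linarith
  have hza : ∀ a ∈ s, η ≤ ‖z - a‖ := fun a ha =>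
    (hzs ‖a‖ (Multiset.mem_toFinset.2 (Multiset.mem_map_of_mem _ ha))).trans
      (abs_norm_sub_norm_le z a)
  obtain ⟨hb1, hb2⟩ := zero_free_bounds hh hr hδ0 rfl hne (M₁ := B + n * V) (M₂ := Λ + n * V)
    (by positivity) hup hlow hz
  have hEη : E ≤ E / η := by
    rw [le_div_iff₀ hη]; nlinarith
  have hnη : n / η ≤ E / η := by gcongr; linarith
  have hRV : r + δ ≤ V := by linarith
  constructor
  · have hPz : ‖deriv (rootProd s) z‖ ≤ n / η * ‖rootProd s z‖ := norm_deriv_rootProd_le hη hza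
    have hd : deriv g z = deriv (rootProd s) z * h z + rootProd s z * deriv h z := by
      rw [show g = fun z => rootProd s z * h z from funext hgs]
      exact deriv_fun_mul (differentiable_rootProd s z) (hh z)
    have h24 : 8 * (B + n * V + (Λ + n * V)) * (r + δ) / δ ^ 2 ≤ 24 * E := by
      calc 8 * (B + n * V + (Λ + n * V)) * (r + δ) / δ ^ 2
          ≤ 8 * (3 * ((1 + Λ) * V ^ 3 * B)) * V / δ ^ 2 := by gcongr
        _ = 24 * E := by rw [hE, hδ]; field_simp; ring
    rw [hd, hgs z]
    calc _ ≤ ‖deriv (rootProd s) z‖ * ‖h z‖ + ‖rootProd s z‖ * ‖deriv h z‖ := by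
          rw [← norm_mul, ← norm_mul]; exact norm_add_le _ _
      _ ≤ (n / η * ‖rootProd s z‖) * ‖h z‖ + ‖rootProd s z‖ * (24 * E * ‖h z‖) := by
          gcongr
          exact hb1.trans (by gcongr)
      _ = (n / η + 24 * E) * (‖rootProd s z‖ * ‖h z‖) := by ring
      _ ≤ (25 * E / η) * (‖rootProd s z‖ * ‖h z‖) := by
          gcongr
          rw [mul_div_assoc]
          linarith
      _ = _ := by rw [norm_mul]
  · have hPz : η ^ s.card ≤ ‖rootProd s z‖ := le_norm_rootProd hη.le hza
    have h6 : 2 * (B + n * V + (Λ + n * V)) * (r + δ) / δ ≤ 6 * E := by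
      calc 2 * (B + n * V + (Λ + n * V)) * (r + δ) / δ
          ≤ 2 * (3 * ((1 + Λ) * V ^ 3 * B)) * V / δ := by gcongr
        _ = 6 * ((1 + Λ) * V ^ 5 * B) := by rw [hδ]; field_simp; ring
        _ ≤ 6 * E := by linarith
    have hM2 : Λ + n * V ≤ 2 * E := by nlinarith
    rw [hgs z, norm_mul]
    calc Real.exp (-(25 * E / η)) ≤ Real.exp (-(n / η)) *
          Real.exp (-(Λ + n * V + 2 * (B + n * V + (Λ + n * V)) * (r + δ) / δ)) := by
          rw [← Real.exp_add, Real.exp_le_exp, mul_div_assoc]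
          linarith
      _ ≤ η ^ s.card * ‖h z‖ := by
          gcongr
          exact exp_neg_div_le_pow hη s.card
      _ ≤ _ := by gcongr

/-- Any interval contains a radius staying quantitatively away from a finite set. -/
lemma exists_radius_away (s : Finset ℝ) (r : ℝ) {δ : ℝ} (hδ : 0 < δ) :
    ∃ r', r ≤ r' ∧ r' ≤ r + δ ∧ ∀ t ∈ s, δ / (2 * (s.card + 1)) ≤ |r' - t| := by
  by_contra! hcon
  set N : ℝ := s.card + 1 with hN
  have hN0 : 0 < N := by positivity
  have h : ∀ j ∈ Finset.range (s.card + 1), ∃ t ∈ s, |r + j * (δ / N) - t| < δ / (2 * N) := by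
    intro j hj
    refine hcon _ (by simp; positivity) ?_
    have : (j : ℝ) ≤ N := by
      rw [hN]; exact_mod_cast (Finset.mem_range.1 hj).le
    have : (j : ℝ) * (δ / N) ≤ N * (δ / N) := by gcongr
    rw [mul_div_cancel₀ _ hN0.ne'] at this
    linarith
  choose! t ht htd using h
  obtain ⟨i, hi, j, hj, hij, he⟩ := Finset.exists_ne_map_eq_of_card_lt_of_maps_to
    (s := Finset.range (s.card + 1)) (t := s) (by simp) (f := t) ht
  have h1 := htd i hi
  have h2 := htd j hj
  rw [he] at h1
  have h3 : |((i : ℝ) - j) * (δ / N)| < δ / N := by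
    rw [abs_lt] at h1 h2 ⊢
    have : δ / (2 * N) = δ / N / 2 := by field_simp
    constructor <;> linarith [h1.1, h1.2, h2.1, h2.2]
  have hpos : 0 < δ / N := by positivity
  rw [abs_mul, abs_of_pos hpos, mul_lt_iff_lt_one_left hpos] at h3
  have : |((i : ℤ) - j)| < 1 := by exact_mod_cast h3
  rw [Int.abs_lt_one_iff] at this
  omega

/-- A finite family of entire functions has controlled logarithmic derivatives and lower bounds
on a common circle. -/
lemma exists_circle_logDeriv_bound {ι : Type*} [Fintype ι] {g : ι → ℂ → ℂ}
    (hg : ∀ i, Differentiable ℂ (g i)) (hg0 : ∀ i, g i 0 ≠ 0) :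
    ∃ C : ℝ, 1 ≤ C ∧ ∀ V B r : ℝ, 1 ≤ V → 1 ≤ B → 0 ≤ r → r + 3 / V ≤ V →
      (∀ i z, ‖z‖ ≤ r + 3 / V → ‖g i z‖ ≤ Real.exp B) →
      ∃ r', r ≤ r' ∧ r' ≤ r + 1 / V ∧ ∀ i z, ‖z‖ = r' →
        ‖deriv (g i) z‖ ≤ C * (V * B) ^ 13 * ‖g i z‖ ∧
          Real.exp (-(C * (V * B) ^ 13)) ≤ ‖g i z‖ := by
  classical
  choose C hC1 hC using fun i => exists_logDeriv_bound (hg i) (hg0 i)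
  set S : ℝ := 1 + ∑ i, C i with hS
  have hC0 : ∀ i, 0 ≤ C i := fun i => by linarith [hC1 i]
  have hCS : ∀ i, C i ≤ S := fun i => by
    have := Finset.single_le_sum (f := C) (fun j _ => hC0 j) (Finset.mem_univ i)
    linarith
  have hS1 : 1 ≤ S := by
    have := Finset.sum_nonneg (s := Finset.univ) (f := C) (fun j _ => hC0 j)
    linarith
  refine ⟨4 * S ^ 2, by nlinarith, fun V B r hV hB hr hrV hbd => ?_⟩
  have hV0 : 0 < V := by linarith
  have h3V : r + 3 / V = r + 1 / V + 2 / V := by ring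
  rw [h3V] at hrV hbd
  choose s hs hsb using fun i => hC i V B (r + 1 / V) hV hB (by positivity) hrV (hbd i)
  obtain ⟨r', hr1, hr2, hr3⟩ := exists_radius_away (Finset.univ.biUnion s) r (δ := 1 / V)
    (by positivity)
  refine ⟨r', hr1, hr2, fun i z hz => ?_⟩
  set N : ℝ := ((Finset.univ.biUnion s).card : ℝ) with hN
  have hN0 : 0 ≤ N := Nat.cast_nonneg _
  have hX : 1 ≤ V ^ 6 * B := one_le_mul_of_one_le_of_one_le (one_le_pow₀ hV) hB
  have hNle : N + 1 ≤ 2 * S * (V ^ 6 * B) := by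
    have h1 : N ≤ ∑ i, ((s i).card : ℝ) := by
      rw [hN]; exact_mod_cast Finset.card_biUnion_le
    have h2 : ∑ i, ((s i).card : ℝ) ≤ ∑ i, C i * (V ^ 6 * B) :=
      Finset.sum_le_sum fun i _ => by rw [← mul_assoc]; exact hs i
    rw [← Finset.sum_mul] at h2
    nlinarith
  have hη : 0 < 1 / V / (2 * (N + 1)) := by positivity
  have hη1 : 1 / V / (2 * (N + 1)) ≤ 1 := by
    rw [div_div, div_le_one (by positivity)]
    nlinarith
  obtain ⟨h1, h2⟩ := hsb i _ hη hη1 z (by rw [hz]; exact hr2) fun t ht => by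
    rw [hz]; exact hr3 t (Finset.mem_biUnion.2 ⟨i, Finset.mem_univ i, ht⟩)
  have hle : C i * V ^ 6 * B / (1 / V / (2 * (N + 1))) ≤ 4 * S ^ 2 * (V * B) ^ 13 := by
    calc C i * V ^ 6 * B / (1 / V / (2 * (N + 1)))
        = C i * (V ^ 6 * B) * V * 2 * (N + 1) := by field_simp
      _ ≤ S * (V ^ 6 * B) * V * 2 * (2 * S * (V ^ 6 * B)) := by
          gcongr
          exact hCS i
      _ = 4 * S ^ 2 * (V ^ 13 * B ^ 2) := by ring
      _ ≤ 4 * S ^ 2 * (V ^ 13 * B ^ 13) := by gcongr; norm_num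
      _ = _ := by ring
  exact ⟨h1.trans (by gcongr), le_trans (Real.exp_le_exp.2 (neg_le_neg hle)) h2⟩

lemma norm_iteratedDeriv_le_exp {F : ℂ → ℂ} (hF : Differentiable ℂ F) {j k : ℕ} (hjk : j ≤ k)
    {V B R : ℝ} (hV : 1 ≤ V) (hB : 1 ≤ B) (h : ∀ z, ‖z‖ ≤ R + 1 / V → ‖F z‖ ≤ Real.exp B)
    {z : ℂ} (hz : ‖z‖ ≤ R) :
    ‖iteratedDeriv j F z‖ ≤ Real.exp ((k.factorial + k + 2) * (V * B)) := by
  have hV0 : 0 < V := by linarith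
  have h1 := Complex.norm_iteratedDeriv_le_of_forall_mem_sphere_norm_le (n := j) (c := z)
    (R := 1 / V) (C := Real.exp B) (by positivity) hF.diffContOnCl (fun w hw => h w (by
      have := norm_le_norm_add_norm_sub z w
      rw [mem_sphere, dist_eq_norm, ← norm_neg, neg_sub] at hw
      linarith))
  have h2 : (j.factorial : ℝ) ≤ Real.exp k.factorial := by
    have h3 : (j.factorial : ℝ) ≤ k.factorial := by exact_mod_cast Nat.factorial_le hjk
    linarith [Real.add_one_le_exp (k.factorial : ℝ)]
  have h3 : V ^ j ≤ Real.exp (k * V) := by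
    rw [Real.exp_nat_mul]
    calc V ^ j ≤ V ^ k := pow_le_pow_right₀ hV hjk
      _ ≤ _ := by gcongr; linarith [Real.add_one_le_exp V]
  calc _ ≤ _ := h1
    _ = j.factorial * V ^ j * Real.exp B := by rw [one_div, inv_pow, div_inv_eq_mul]; ring
    _ ≤ Real.exp k.factorial * Real.exp (k * V) * Real.exp B := by gcongr
    _ = Real.exp (k.factorial + k * V + B) := by rw [Real.exp_add, Real.exp_add]
    _ ≤ _ := by
      rw [Real.exp_le_exp]
      have hVB : 1 ≤ V * B := one_le_mul_of_one_le_of_one_le hV hB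
      have e1 : (k.factorial : ℝ) * 1 ≤ k.factorial * (V * B) := by gcongr
      have e2 : (k : ℝ) * V ≤ k * (V * B) := by gcongr; exact le_mul_of_one_le_right hV0.le hB
      have e3 : B ≤ V * B := le_mul_of_one_le_left (by linarith) hV
      nlinarith

/-- The data of entire functions `φ`, `D` with `φ = F' (F - F⁽ᵏ⁾) / (F (F - 1))` and
`D = φ ^ (k + 2) / F`. -/
structure IsAux (k : ℕ) (F φ D : ℂ → ℂ) : Prop where
  diff : Differentiable ℂ F
  diff_phi : Differentiable ℂ φ
  diff_D : Differentiable ℂ D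
  phi_eq : ∀ z, φ z * (F z * (F z - 1)) = deriv F z * (F z - iteratedDeriv k F z)
  D_eq : ∀ z, D z * F z = φ z ^ (k + 2)

lemma IsAux.bounds_of_logDeriv {k : ℕ} {F φ D : ℂ → ℂ} (h : IsAux k F φ D) {A : ℝ} (hA : 1 ≤ A)
    {z : ℂ} (h0 : F z ≠ 0) (h1 : F z - 1 ≠ 0)
    (hK : ‖deriv F z‖ ≤ A * ‖F z - 1‖)
    (hL : ‖deriv F z‖ ≤ A * ‖F z‖) (hQ : ‖iteratedDeriv k F z‖ ≤ A ^ k * ‖F z‖) :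
    ‖φ z‖ ≤ 2 * A ^ (k + 1) ∧ ‖D z‖ ≤ 2 ^ (k + 3) * A ^ ((k + 1) * (k + 2)) := by
  have h0' := norm_pos_iff.2 h0
  have h1' := norm_pos_iff.2 h1
  have hA0 : 0 ≤ A := by linarith
  have hAk : 1 ≤ A ^ k := one_le_pow₀ hA
  have hsub : ‖F z - iteratedDeriv k F z‖ ≤ 2 * A ^ k * ‖F z‖ := by
    refine (norm_sub_le _ _).trans ?_
    nlinarith
  have hφ : ‖φ z‖ ≤ 2 * A ^ (k + 1) := by
    have e := congrArg norm (h.phi_eq z)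
    simp only [norm_mul] at e
    have : ‖φ z‖ * (‖F z‖ * ‖F z - 1‖) ≤ 2 * A ^ (k + 1) * (‖F z‖ * ‖F z - 1‖) := by
      rw [e]
      calc _ ≤ (A * ‖F z - 1‖) * (2 * A ^ k * ‖F z‖) := by gcongr
        _ = _ := by ring
    exact le_of_mul_le_mul_right this (by positivity)
  refine ⟨hφ, ?_⟩
  have hφ2 : ‖φ z‖ ≤ 4 * A ^ (k + 1) * ‖F z‖ := by
    have e : φ z * F z = φ z * F z * F z - deriv F z * (F z - iteratedDeriv k F z) := by
      rw [← h.phi_eq z]; ring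
    have e2 := congrArg norm e
    rw [norm_mul] at e2
    have : ‖φ z‖ * ‖F z‖ ≤ 4 * A ^ (k + 1) * ‖F z‖ * ‖F z‖ := by
      rw [e2]
      refine (norm_sub_le _ _).trans ?_
      rw [norm_mul, norm_mul, norm_mul]
      calc _ ≤ 2 * A ^ (k + 1) * ‖F z‖ * ‖F z‖ + (A * ‖F z‖) * (2 * A ^ k * ‖F z‖) := by gcongr
        _ = _ := by ring
    exact le_of_mul_le_mul_right this h0'
  have e := congrArg norm (h.D_eq z)
  rw [norm_mul, norm_pow, pow_succ] at e
  have : ‖D z‖ * ‖F z‖ ≤ 2 ^ (k + 3) * A ^ ((k + 1) * (k + 2)) * ‖F z‖ := by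
    rw [e]
    calc _ ≤ (2 * A ^ (k + 1)) ^ (k + 1) * (4 * A ^ (k + 1) * ‖F z‖) := by gcongr
      _ = _ := by
        rw [mul_pow, ← pow_mul]
        ring
  exact le_of_mul_le_mul_right this h0'

lemma norm_iteratedDeriv_le_pow {F : ℂ → ℂ} {k : ℕ} {A : ℝ} (hA : 0 ≤ A) {z : ℂ}
    (h : ∀ j < k, ‖deriv (iteratedDeriv j F) z‖ ≤ A * ‖iteratedDeriv j F z‖) :
    ‖iteratedDeriv k F z‖ ≤ A ^ k * ‖F z‖ := by
  induction k with
  | zero => simp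
  | succ k ih =>
    rw [iteratedDeriv_succ, pow_succ']
    refine (h k (by omega)).trans ?_
    rw [mul_assoc]
    gcongr
    exact ih fun j hj => h j (by omega)

lemma IsAux.exists_bound {k : ℕ} {F φ D : ℂ → ℂ} (h : IsAux k F φ D) (hk : 1 ≤ k)
    (h1 : F 0 ≠ 1) (hj : ∀ j < k, iteratedDeriv j F 0 ≠ 0) :
    ∃ (C : ℝ) (m : ℕ), 1 ≤ C ∧ ∀ V B r : ℝ, 1 ≤ V → 1 ≤ B → 0 ≤ r → r + 4 / V ≤ V →
      (∀ z, ‖z‖ ≤ r + 4 / V → ‖F z‖ ≤ Real.exp B) →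
      ∀ z, ‖z‖ ≤ r → ‖φ z‖ ≤ C * (V * B) ^ m ∧ ‖D z‖ ≤ C * (V * B) ^ m := by
  have hdj : ∀ j, Differentiable ℂ (iteratedDeriv j F) := fun j =>
    (h.diff.contDiff (n := ⊤)).differentiable_iteratedDeriv j (by exact_mod_cast WithTop.coe_lt_top _)
  let g : Option (Fin k) → ℂ → ℂ := fun i => i.elim (fun z => F z - 1) (fun j => iteratedDeriv j F)
  obtain ⟨C, hC1, hC⟩ := exists_circle_logDeriv_bound (g := g)
    (by rintro (_ | j); exacts [h.diff.sub_const 1, hdj j])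
    (by rintro (_ | j); exacts [sub_ne_zero.2 h1, hj j j.2])
  set C₁ : ℝ := k.factorial + k + 2 with hC₁
  have hC₁2 : 2 ≤ C₁ := by rw [hC₁]; have : (0 : ℝ) ≤ k.factorial + k := by positivity
                           linarith
  refine ⟨2 ^ (k + 3) * (C * C₁ ^ 13) ^ ((k + 1) * (k + 2)), 26 * ((k + 1) * (k + 2)), ?_, ?_⟩
  · exact one_le_mul_of_one_le_of_one_le (one_le_pow₀ (by norm_num))
      (one_le_pow₀ (one_le_mul_of_one_le_of_one_le hC1 (one_le_pow₀ (by linarith))))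
  intro V B r hV hB hr hrV hbd
  have hV0 : 0 < V := by linarith
  have hVB : 1 ≤ V * B := one_le_mul_of_one_le_of_one_le hV hB
  have h4V : r + 4 / V = r + 3 / V + 1 / V := by ring
  have hpos : 0 < 1 / V := by positivity
  rw [h4V] at hrV hbd
  have hB' : 1 ≤ C₁ * (V * B) := by nlinarith
  obtain ⟨r', hr1, -, hr3⟩ := hC V (C₁ * (V * B)) r hV hB' hr (by linarith) (by
    rintro (_ | j) z hz
    · have e1 := hbd z (by linarith)
      have e2 : ‖F z - 1‖ ≤ Real.exp B + 1 := (norm_sub_le _ _).trans (by simpa using e1)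
      have e3 : Real.exp B + 1 ≤ Real.exp (B + 1) := by
        rw [Real.exp_add]
        have := Real.add_one_le_exp B
        have := Real.add_one_le_exp 1
        nlinarith
      refine e2.trans (e3.trans (Real.exp_le_exp.2 ?_))
      nlinarith
    · exact norm_iteratedDeriv_le_exp h.diff j.2.le hV hB hbd hz)
  set A : ℝ := C * (V * (C₁ * (V * B))) ^ 13 with hA
  have hA1 : 1 ≤ A := one_le_mul_of_one_le_of_one_le hC1
    (one_le_pow₀ (one_le_mul_of_one_le_of_one_le hV hB'))
  have hAle : A ≤ C * C₁ ^ 13 * (V * B) ^ 26 := by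
    calc A = C * C₁ ^ 13 * (V ^ 26 * B ^ 13) := by rw [hA]; ring
      _ ≤ C * C₁ ^ 13 * (V ^ 26 * B ^ 26) := by gcongr; norm_num
      _ = _ := by ring
  have hfin : 2 ^ (k + 3) * A ^ ((k + 1) * (k + 2)) ≤
      2 ^ (k + 3) * (C * C₁ ^ 13) ^ ((k + 1) * (k + 2)) * (V * B) ^ (26 * ((k + 1) * (k + 2))) := by
    rw [pow_mul (V * B), mul_assoc, ← mul_pow]
    gcongr
  have hfin' : 2 * A ^ (k + 1) ≤ 2 ^ (k + 3) * A ^ ((k + 1) * (k + 2)) := by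
    gcongr
    · exact le_self_pow₀ (by norm_num) (by omega)
    · nlinarith
  have hcirc : ∀ z, ‖z‖ = r' → ‖φ z‖ ≤ 2 * A ^ (k + 1) ∧
      ‖D z‖ ≤ 2 ^ (k + 3) * A ^ ((k + 1) * (k + 2)) := by
    intro z hz
    obtain ⟨a1, a2⟩ := hr3 none z hz
    have a3 := fun j : Fin k => hr3 (some j) z hz
    obtain ⟨a4, a5⟩ := a3 ⟨0, hk⟩
    simp only [g, Option.elim, iteratedDeriv_zero, deriv_sub_const] at a1 a2 a3 a4 a5
    refine h.bounds_of_logDeriv hA1 (norm_pos_iff.1 ((Real.exp_pos _).trans_le a5))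
      (norm_pos_iff.1 ((Real.exp_pos _).trans_le a2)) a1 a4
      (norm_iteratedDeriv_le_pow (by linarith) fun j hj => (a3 ⟨j, hj⟩).1)
  intro z hz
  exact ⟨(norm_le_of_forall_sphere h.diff_phi (fun w hw => (hcirc w hw).1) (hz.trans hr1)).trans
      (hfin'.trans hfin),
    (norm_le_of_forall_sphere h.diff_D (fun w hw => (hcirc w hw).2) (hz.trans hr1)).trans hfin⟩

lemma mul_pow_le_of_le_mul {V X C β : ℝ} (hV : 0 ≤ V) (hX : 0 ≤ X) (hβ : 1 ≤ β) (hC : 0 ≤ C)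
    (h : X ≤ C * (V * β)) : (V * X) ^ 13 ≤ C ^ 13 * (V * β) ^ 26 := by
  calc (V * X) ^ 13 ≤ (V * (C * (V * β))) ^ 13 := by gcongr
    _ = C ^ 13 * (V ^ 26 * β ^ 13) := by ring
    _ ≤ C ^ 13 * (V ^ 26 * β ^ 26) := by gcongr; norm_num
    _ = _ := by ring

lemma IsAux.exists_improved_bound {k : ℕ} {F φ D : ℂ → ℂ} (h : IsAux k F φ D) (hk : 1 ≤ k)
    (h1 : F 0 ≠ 1) (hj : ∀ j < k, iteratedDeriv j F 0 ≠ 0) (hD0 : D 0 ≠ 0) :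
    ∃ (C : ℝ) (m : ℕ), 1 ≤ C ∧ ∀ V B r : ℝ, 1 ≤ V → 1 ≤ B → 0 ≤ r → r + 7 / V ≤ V →
      (∀ z, ‖z‖ ≤ r + 7 / V → ‖F z‖ ≤ Real.exp B) →
      ∀ z, ‖z‖ ≤ r → ‖F z‖ ≤ Real.exp (C * (V * (1 + Real.log B)) ^ m) := by
  obtain ⟨C₀, m, hC₀, hb⟩ := h.exists_bound hk h1 hj
  obtain ⟨C₁, hC₁, hcirc⟩ := exists_circle_logDeriv_bound (ι := Unit) (g := fun _ => D)
    (fun _ => h.diff_D) (fun _ => hD0)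
  have hlog0 : 0 ≤ Real.log C₀ := Real.log_nonneg hC₀
  set C₂ : ℝ := 1 + Real.log C₀ + 2 * m with hC₂
  have hC₂1 : 1 ≤ C₂ := by
    have : (0 : ℝ) ≤ m := Nat.cast_nonneg m
    linarith
  refine ⟨(k + 2 + C₁) * C₂ ^ 13, 26, one_le_mul_of_one_le_of_one_le (by
    have : (0 : ℝ) ≤ k := Nat.cast_nonneg k
    linarith) (one_le_pow₀ hC₂1), fun V B r hV hB hr hrV hbd => ?_⟩
  have hV0 : 0 < V := by linarith
  have hVB : 1 ≤ V * B := one_le_mul_of_one_le_of_one_le hV hB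
  have hlogB : 0 ≤ Real.log B := Real.log_nonneg hB
  have e7 : r + 7 / V = r + 3 / V + 4 / V := by ring
  rw [e7] at hrV hbd
  have hb' := hb V B (r + 3 / V) hV hB (by positivity) hrV hbd
  set T : ℝ := C₀ * (V * B) ^ m with hT
  have hT1 : 1 ≤ T := one_le_mul_of_one_le_of_one_le hC₀ (one_le_pow₀ hVB)
  set B₂ : ℝ := 1 + Real.log T with hB₂
  have hB₂1 : 1 ≤ B₂ := by linarith [Real.log_nonneg hT1]
  have hTB : T ≤ Real.exp B₂ := by
    rw [← Real.exp_log (by linarith : 0 < T), Real.exp_le_exp]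
    linarith
  have hpos : 0 < 4 / V := by positivity
  obtain ⟨r', hr1, hr2, hr3⟩ := hcirc V B₂ r hV hB₂1 hr (by linarith)
    (fun _ z hz => ((hb' z hz).2.trans hTB))
  have hB₂le : B₂ ≤ C₂ * (V * (1 + Real.log B)) := by
    have e : Real.log T = Real.log C₀ + m * (Real.log V + Real.log B) := by
      rw [hT, Real.log_mul (by linarith) (by positivity), Real.log_pow,
        Real.log_mul hV0.ne' (by linarith)]
    have hX : 1 ≤ V * (1 + Real.log B) := one_le_mul_of_one_le_of_one_le hV (by linarith)
    have hlogV : Real.log V ≤ V := by linarith [Real.log_le_sub_one_of_pos hV0]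
    have h2 : Real.log V + Real.log B ≤ 2 * (V * (1 + Real.log B)) := by nlinarith
    have h3 : (m : ℝ) * (Real.log V + Real.log B) ≤ m * (2 * (V * (1 + Real.log B))) := by gcongr
    have h4 : (1 + Real.log C₀) * 1 ≤ (1 + Real.log C₀) * (V * (1 + Real.log B)) := by gcongr
    rw [hB₂, e, hC₂]
    linarith
  intro z hz
  refine norm_le_of_forall_sphere h.diff (r := r') (fun w hw => ?_) (hz.trans hr1)
  have hlow := (hr3 () w hw).2
  have e := congrArg norm (h.D_eq w)
  rw [norm_mul, norm_pow] at e
  have hφ : ‖φ w‖ ≤ Real.exp B₂ := by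
    refine le_trans (norm_le_of_forall_sphere h.diff_phi (r := r + 3 / V)
      (fun v hv => ((hb' v hv.le).1)) ?_) hTB
    have : 1 / V ≤ 3 / V := by gcongr; norm_num
    exact hw.le.trans (hr2.trans (add_le_add_right this r))
  have h5 : Real.exp (-(C₁ * (V * B₂) ^ 13)) * ‖F w‖ ≤ Real.exp ((k + 2 : ℕ) * B₂) := by
    rw [Real.exp_nat_mul]
    calc _ ≤ ‖D w‖ * ‖F w‖ := by gcongr
      _ = ‖φ w‖ ^ (k + 2) := e
      _ ≤ _ := by gcongr
  rw [Real.exp_neg, inv_mul_le_iff₀ (Real.exp_pos _), ← Real.exp_add] at h5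
  have hB₂V : B₂ ≤ (V * B₂) ^ 13 :=
    (le_mul_of_one_le_left (zero_le_one.trans hB₂1) hV).trans
      (le_self_pow₀ (one_le_mul_of_one_le_of_one_le hV hB₂1) (by norm_num))
  have hVB₂ : (V * B₂) ^ 13 ≤ C₂ ^ 13 * (V * (1 + Real.log B)) ^ 26 :=
    mul_pow_le_of_le_mul hV0.le (zero_le_one.trans hB₂1) (le_add_of_nonneg_right hlogB)
      (zero_le_one.trans hC₂1) hB₂le
  refine h5.trans (Real.exp_le_exp.2 ?_)
  push_cast
  calc C₁ * (V * B₂) ^ 13 + (k + 2) * B₂ ≤ C₁ * (V * B₂) ^ 13 + (k + 2) * (V * B₂) ^ 13 := by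
        gcongr
    _ = (k + 2 + C₁) * (V * B₂) ^ 13 := by ring
    _ ≤ (k + 2 + C₁) * (C₂ ^ 13 * (V * (1 + Real.log B)) ^ 26) := by gcongr
    _ = _ := (mul_assoc _ _ _).symm

/-- A growth lemma of Borel type. -/
lemma exists_radius_le_two_mul {β : ℝ → ℝ} (hmono : Monotone β) (h1 : ∀ r, 1 ≤ β r) (r₀ : ℝ) :
    ∃ r ≥ r₀, β (r + 1 / β r) ≤ 2 * β r := by
  by_contra! hcon
  let u : ℕ → ℝ := fun j => (fun r => r + 1 / β r)^[j] r₀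
  have hu : ∀ j, u (j + 1) = u j + 1 / β (u j) := fun j => Function.iterate_succ_apply' _ _ _
  have key : ∀ j, r₀ ≤ u j ∧ 2 ^ j ≤ β (u j) ∧ u j ≤ r₀ + 2 - 2 * (1 / 2) ^ j := by
    intro j
    induction j with
    | zero => exact ⟨le_rfl, by simpa using h1 _, by simp [u]⟩
    | succ j ih =>
      obtain ⟨i1, i2, i3⟩ := ih
      have hpos : 0 < β (u j) := by linarith [h1 (u j)]
      have := hcon (u j) i1
      rw [← hu j] at this
      have hle : 1 / β (u j) ≤ (1 / 2) ^ j := by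
        rw [one_div_pow]
        gcongr
      refine ⟨?_, ?_, ?_⟩
      · rw [hu j]
        have : 0 < 1 / β (u j) := by positivity
        linarith
      · rw [pow_succ]; linarith
      · rw [hu j, pow_succ]; linarith
  obtain ⟨N, hN⟩ := pow_unbounded_of_one_lt (β (r₀ + 2)) (one_lt_two (α := ℝ))
  obtain ⟨-, k2, k3⟩ := key N
  have : u N ≤ r₀ + 2 := k3.trans (by
    have : (0 : ℝ) < (1 / 2) ^ N := by positivity
    linarith)
  linarith [hmono this]

/-- A monotone growth function for the logarithm of the modulus of a continuous function. -/
lemma exists_log_growth {F : ℂ → ℂ} (hF : Continuous F) :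
    ∃ B : ℝ → ℝ, Monotone B ∧ (∀ r, 1 ≤ B r) ∧ (∀ r z, ‖z‖ ≤ r → ‖F z‖ ≤ Real.exp (B r)) ∧
      ∀ r T, 1 ≤ T → (∀ z, ‖z‖ ≤ r → ‖F z‖ ≤ Real.exp T) → B r ≤ T := by
  let S : ℝ → Set ℝ := fun r => {T | 1 ≤ T ∧ ∀ z, ‖z‖ ≤ r → ‖F z‖ ≤ Real.exp T}
  have hbdd : ∀ r, BddBelow (S r) := fun r => ⟨1, fun T hT => hT.1⟩
  have hne : ∀ r, (S r).Nonempty := by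
    intro r
    obtain ⟨M, hM⟩ := (isCompact_closedBall (0 : ℂ) r).exists_bound_of_continuousOn hF.continuousOn
    refine ⟨max 1 M, le_max_left _ _, fun z hz => ?_⟩
    have e1 := hM z (by simpa using hz)
    linarith [Real.add_one_le_exp (max 1 M), le_max_right 1 M]
  have hmem : ∀ r, sInf (S r) ∈ S r := by
    intro r
    refine ⟨le_csInf (hne r) fun T hT => hT.1, fun z hz => ?_⟩
    rcases eq_or_ne (F z) 0 with h0 | h0
    · rw [h0, norm_zero]; positivity
    · rw [← Real.log_le_iff_le_exp (norm_pos_iff.2 h0)]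
      refine le_csInf (hne r) fun T hT => ?_
      rw [Real.log_le_iff_le_exp (norm_pos_iff.2 h0)]
      exact hT.2 z hz
  exact ⟨fun r => sInf (S r), fun a b hab => csInf_le (hbdd a)
    ⟨(hmem b).1, fun z hz => (hmem b).2 z (hz.trans hab)⟩, fun r => (hmem r).1,
    fun r => (hmem r).2, fun r T h1 h2 => csInf_le (hbdd r) ⟨h1, h2⟩⟩

lemma one_add_log_pow_le {B : ℝ} (hB : 1 ≤ B) (m : ℕ) :
    (1 + Real.log B) ^ m ≤ (2 * m + 1) ^ m * Real.sqrt B := by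
  have hB0 : 0 < B := by linarith
  have hl : 0 ≤ Real.log B := Real.log_nonneg hB
  have hm : (0 : ℝ) ≤ m := Nat.cast_nonneg m
  have h1 : 1 + Real.log B ≤ (2 * m + 1) * Real.exp (Real.log B / (2 * m + 1)) := by
    have := Real.add_one_le_exp (Real.log B / (2 * m + 1))
    calc 1 + Real.log B ≤ (2 * m + 1) * (Real.log B / (2 * m + 1) + 1) := by
          rw [mul_add, mul_div_cancel₀ _ (by positivity)]; linarith
      _ ≤ _ := by gcongr
  calc (1 + Real.log B) ^ m ≤ ((2 * m + 1) * Real.exp (Real.log B / (2 * m + 1))) ^ m := by gcongr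
    _ = (2 * m + 1) ^ m * Real.exp (m * (Real.log B / (2 * m + 1))) := by
        rw [mul_pow, Real.exp_nat_mul]
    _ ≤ (2 * m + 1) ^ m * Real.exp (Real.log B / 2) := by
        gcongr
        rw [mul_div_assoc', div_le_div_iff₀ (by positivity) (by norm_num)]
        nlinarith
    _ = _ := by
        rw [Real.sqrt_eq_rpow, Real.rpow_def_of_pos hB0]
        ring_nf

lemma IsAux.exists_finite_order {k : ℕ} {F φ D : ℂ → ℂ} (h : IsAux k F φ D) (hk : 1 ≤ k)
    (h1 : F 0 ≠ 1) (hj : ∀ j < k, iteratedDeriv j F 0 ≠ 0) (hD0 : D 0 ≠ 0) :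
    ∃ (C : ℝ) (m : ℕ), 1 ≤ C ∧ ∀ r₀ : ℝ, ∃ r ≥ r₀,
      ∀ z, ‖z‖ ≤ r → ‖F z‖ ≤ Real.exp (C * (r + 1) ^ m) := by
  obtain ⟨C, m, hC1, hC⟩ := h.exists_improved_bound hk h1 hj hD0
  obtain ⟨B, hBm, hB1, hBF, hBle⟩ := exists_log_growth h.diff.continuous
  set K : ℝ := (2 * (2 * m : ℕ) + 1) ^ (2 * m) with hK
  have hK1 : 1 ≤ K := one_le_pow₀ (by
    have : (0 : ℝ) ≤ (2 * m : ℕ) := Nat.cast_nonneg _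
    linarith)
  refine ⟨(C * 14 ^ m * K) ^ 2, m * 2, one_le_pow₀ (one_le_mul_of_one_le_of_one_le
    (one_le_mul_of_one_le_of_one_le hC1 (one_le_pow₀ (by norm_num))) hK1), fun r₀ => ?_⟩
  have hlog : ∀ r, 0 ≤ Real.log (B r) := fun r => Real.log_nonneg (hB1 r)
  obtain ⟨r, hr, hβ⟩ := exists_radius_le_two_mul (β := fun r => 1 + Real.log (B r))
    (fun a b hab => by
      have := Real.log_le_log (by linarith [hB1 a]) (hBm hab)
      simp only
      linarith) (fun r => by linarith [hlog r]) (max r₀ 0)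
  have hr0 : 0 ≤ r := (le_max_right _ _).trans hr
  refine ⟨r, (le_max_left _ _).trans hr, fun z hz => ?_⟩
  set β : ℝ := 1 + Real.log (B r) with hβd
  have hβ1 : 1 ≤ β := by linarith [hlog r]
  set V : ℝ := 7 * (r + 1) * β with hV
  have hV1 : 7 * (r + 1) ≤ V := le_mul_of_one_le_right (by positivity) hβ1
  have hV0 : 0 < V := by linarith
  have h7V : 7 / V ≤ 1 / β := by
    rw [div_le_div_iff₀ hV0 (by linarith), hV]; nlinarith
  have h7V' : 7 / V ≤ 1 := by rw [div_le_one hV0]; linarith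
  have hF := hC V (B (r + 7 / V)) r (by linarith) (hB1 _) hr0 (by linarith) (hBF _)
  have hlog2 : 1 + Real.log (B (r + 7 / V)) ≤ 2 * β := by
    refine le_trans ?_ hβ
    gcongr
    · linarith [hB1 (r + 7 / V)]
    · exact hBm (by linarith)
  have hV2 : 1 ≤ V * (1 + Real.log (B (r + 7 / V))) :=
    one_le_mul_of_one_le_of_one_le (by linarith) (by linarith [hlog (r + 7 / V)])
  have hBr := hBle r _ (one_le_mul_of_one_le_of_one_le hC1 (one_le_pow₀ hV2)) hF
  have hsq : B r ≤ C * 14 ^ m * K * (r + 1) ^ m * Real.sqrt (B r) := by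
    calc B r ≤ C * (V * (1 + Real.log (B (r + 7 / V)))) ^ m := hBr
      _ ≤ C * (V * (2 * β)) ^ m := by
          gcongr
      _ = C * 14 ^ m * (r + 1) ^ m * β ^ (2 * m) := by
          rw [hV, pow_mul β 2 m, mul_assoc C, mul_assoc C, ← mul_pow, ← mul_pow]
          ring
      _ ≤ C * 14 ^ m * (r + 1) ^ m * (K * Real.sqrt (B r)) := by
          gcongr
          exact one_add_log_pow_le (hB1 r) (2 * m)
      _ = _ := by ring
  have hBr0 : 0 < B r := by linarith [hB1 r]
  have hs : Real.sqrt (B r) ≤ C * 14 ^ m * K * (r + 1) ^ m := by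
    have e := Real.mul_self_sqrt hBr0.le
    have hp : 0 < Real.sqrt (B r) := Real.sqrt_pos.2 hBr0
    refine le_of_mul_le_mul_right ?_ hp
    rw [e]; exact hsq
  refine (hBF r z hz).trans (Real.exp_le_exp.2 ?_)
  calc B r = Real.sqrt (B r) ^ 2 := (Real.sq_sqrt hBr0.le).symm
    _ ≤ (C * 14 ^ m * K * (r + 1) ^ m) ^ 2 := by gcongr
    _ = _ := by rw [mul_pow, ← pow_mul]

lemma exists_polynomial_of_iteratedDeriv_eq_zero {g : ℂ → ℂ} (hg : Differentiable ℂ g) {N : ℕ}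
    (hz : ∀ n, N < n → iteratedDeriv n g 0 = 0) : ∃ p : Polynomial ℂ, ∀ z, g z = p.eval z := by
  refine ⟨∑ n ∈ Finset.range (N + 1),
    Polynomial.monomial n ((n.factorial : ℂ)⁻¹ * iteratedDeriv n g 0), fun z => ?_⟩
  rw [← Complex.taylorSeries_eq_of_entire' 0 z hg, tsum_eq_sum (s := Finset.range (N + 1)),
    Polynomial.eval_finsetSum]
  · simp
  · intro n hn
    rw [hz n (by simpa using hn)]
    simp

lemma iteratedDeriv_eq_zero_of_growth {g : ℂ → ℂ} (hg : Differentiable ℂ g) {C : ℝ} {N : ℕ}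
    (h : ∀ r₀ : ℝ, ∃ r ≥ r₀, ∀ z, ‖z‖ ≤ r → ‖g z‖ ≤ C * r ^ N) {n : ℕ} (hn : N < n) :
    iteratedDeriv n g 0 = 0 := by
  by_contra hne
  have hpos := norm_pos_iff.2 hne
  obtain ⟨r, hr, hb⟩ := h (max 1 ((n.factorial * C) / ‖iteratedDeriv n g 0‖ + 1))
  have hr1 : 1 ≤ r := (le_max_left _ _).trans hr
  have hr2 : (n.factorial * C) / ‖iteratedDeriv n g 0‖ + 1 ≤ r := (le_max_right _ _).trans hr
  have h1 := Complex.norm_iteratedDeriv_le_of_forall_mem_sphere_norm_le (n := n) (c := 0)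
    (R := r) (C := C * r ^ N) (by linarith) hg.diffContOnCl fun w hw => hb w (by
      simpa using (mem_sphere_zero_iff_norm.1 hw).le)
  have hr0 : 0 < r := by linarith
  rw [le_div_iff₀ (by positivity)] at h1
  have h2 : r ^ N * r ≤ r ^ n := by
    rw [← pow_succ]; exact pow_le_pow_right₀ hr1 hn
  have h3 : ‖iteratedDeriv n g 0‖ * r * r ^ N ≤ n.factorial * C * r ^ N := by
    calc _ = ‖iteratedDeriv n g 0‖ * (r ^ N * r) := by ring
      _ ≤ ‖iteratedDeriv n g 0‖ * r ^ n := by gcongr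
      _ ≤ _ := by linarith
  have h4 := le_of_mul_le_mul_right h3 (by positivity)
  have h5 : n.factorial * C < r * ‖iteratedDeriv n g 0‖ := by
    rw [← div_lt_iff₀ hpos]; linarith
  linarith

lemma exists_polynomial_of_growth {g : ℂ → ℂ} (hg : Differentiable ℂ g) {C : ℝ} {N : ℕ}
    (h : ∀ r₀ : ℝ, ∃ r ≥ r₀, ∀ z, ‖z‖ ≤ r → ‖g z‖ ≤ C * r ^ N) :
    ∃ p : Polynomial ℂ, ∀ z, g z = p.eval z := by
  exact exists_polynomial_of_iteratedDeriv_eq_zero hg fun n hn =>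
    iteratedDeriv_eq_zero_of_growth hg h hn

lemma exists_polynomial_of_mul {F : ℂ → ℂ} (hF : Continuous F) (d : ℕ) :
    ∀ p q : Polynomial ℂ, p ≠ 0 → p.natDegree = d → (∀ z, F z * p.eval z = q.eval z) →
      ∃ p : Polynomial ℂ, ∀ z, F z = p.eval z := by
  induction d with
  | zero =>
    intro p q hp hd h
    obtain ⟨c, rfl⟩ := Polynomial.natDegree_eq_zero.1 hd
    have hc : c ≠ 0 := by simpa using hp
    refine ⟨Polynomial.C c⁻¹ * q, fun z => ?_⟩
    have := h z
    simp only [Polynomial.eval_C, Polynomial.eval_mul] at this ⊢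
    rw [← this]
    field_simp
  | succ d ih =>
    intro p q hp hd h
    obtain ⟨a, ha⟩ := Complex.exists_root (f := p) (by
      rw [← Polynomial.natDegree_pos_iff_degree_pos]; omega)
    have hq : q.IsRoot a := by rw [Polynomial.IsRoot, ← h a, ha.eq_zero, mul_zero]
    obtain ⟨p', rfl⟩ := Polynomial.dvd_iff_isRoot.2 ha
    obtain ⟨q', rfl⟩ := Polynomial.dvd_iff_isRoot.2 hq
    have hp' : p' ≠ 0 := right_ne_zero_of_mul hp
    refine ih p' q' hp' ?_ fun z => ?_
    · rw [Polynomial.natDegree_mul (Polynomial.X_sub_C_ne_zero a) hp',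
        Polynomial.natDegree_X_sub_C] at hd
      omega
    · have hcont : Continuous fun z => F z * p'.eval z := hF.mul p'.continuous
      refine congrFun (Continuous.ext_on (dense_compl_singleton a) hcont q'.continuous ?_) z
      intro w hw
      have hw' : w - a ≠ 0 := sub_ne_zero.2 hw
      have := h w
      simp only [Polynomial.eval_mul, Polynomial.eval_sub, Polynomial.eval_X,
        Polynomial.eval_C] at this
      refine mul_left_cancel₀ hw' ?_
      simp only
      rw [← this]; ring

/-- If the auxiliary functions are nondegenerate at the origin, then `F` is a polynomial. -/
lemma IsAux.exists_polynomial {k : ℕ} {F φ D : ℂ → ℂ} (h : IsAux k F φ D) (hk : 1 ≤ k)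
    (h1 : F 0 ≠ 1) (hj : ∀ j < k, iteratedDeriv j F 0 ≠ 0) (hD0 : D 0 ≠ 0) :
    ∃ p : Polynomial ℂ, ∀ z, F z = p.eval z := by
  obtain ⟨C₀, m, hC₀, hb⟩ := h.exists_bound hk h1 hj
  obtain ⟨C₁, N, hC₁, hfin⟩ := h.exists_finite_order hk h1 hj hD0
  have hgrow : ∀ r₀ : ℝ, ∃ r ≥ r₀, ∀ z, ‖z‖ ≤ r →
      ‖φ z‖ ≤ C₀ * (3 ^ (N + 1) * C₁) ^ m * r ^ ((N + 1) * m) ∧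
      ‖D z‖ ≤ C₀ * (3 ^ (N + 1) * C₁) ^ m * r ^ ((N + 1) * m) := by
    intro r₀
    obtain ⟨r, hr, hFr⟩ := hfin (max (r₀ + 1) 5)
    have hr5 : 5 ≤ r := (le_max_right _ _).trans hr
    have hr0 : r₀ + 1 ≤ r := (le_max_left _ _).trans hr
    have h4 : 4 / r ≤ 1 := by rw [div_le_one (by linarith)]; linarith
    refine ⟨r - 1, by linarith, fun z hz => ?_⟩
    have hB1 : 1 ≤ C₁ * (r + 1) ^ N :=
      one_le_mul_of_one_le_of_one_le hC₁ (one_le_pow₀ (by linarith))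
    have := hb r (C₁ * (r + 1) ^ N) (r - 1) (by linarith) hB1 (by linarith) (by linarith)
      (fun w hw => hFr w (by linarith)) z hz
    have hle : C₀ * (r * (C₁ * (r + 1) ^ N)) ^ m ≤
        C₀ * (3 ^ (N + 1) * C₁) ^ m * (r - 1) ^ ((N + 1) * m) := by
      have hr1 : 0 ≤ r - 1 := by linarith
      rw [pow_mul, mul_assoc C₀, ← mul_pow]
      have : r * (C₁ * (r + 1) ^ N) ≤ 3 ^ (N + 1) * C₁ * (r - 1) ^ (N + 1) := by
        calc r * (C₁ * (r + 1) ^ N) ≤ (3 * (r - 1)) * (C₁ * (3 * (r - 1)) ^ N) := by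
              gcongr <;> linarith
          _ = _ := by rw [mul_pow]; ring
      gcongr
    exact ⟨this.1.trans hle, this.2.trans hle⟩
  obtain ⟨p, hp⟩ := exists_polynomial_of_growth h.diff_phi fun r₀ => by
    obtain ⟨r, hr, hb⟩ := hgrow r₀
    exact ⟨r, hr, fun z hz => (hb z hz).1⟩
  obtain ⟨q, hq⟩ := exists_polynomial_of_growth h.diff_D fun r₀ => by
    obtain ⟨r, hr, hb⟩ := hgrow r₀
    exact ⟨r, hr, fun z hz => (hb z hz).2⟩
  refine exists_polynomial_of_mul h.diff.continuous _ q (p ^ (k + 2)) ?_ rfl fun z => ?_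
  · rintro rfl
    exact hD0 (by simp [hq 0])
  · rw [← hq, Polynomial.eval_pow, ← hp, ← h.D_eq, mul_comm]

lemma analyticOrderAt_ne_top_of_entire {g : ℂ → ℂ} (hg : Differentiable ℂ g)
    (hne : ¬ ∀ z, g z = 0) (z : ℂ) : analyticOrderAt g z ≠ ⊤ := by
  intro htop
  rw [analyticOrderAt_eq_top] at htop
  have := AnalyticOnNhd.eq_of_eventuallyEq (f := g) (g := fun _ => 0) (fun w _ => hg.analyticAt w)
    (fun w _ => analyticAt_const) htop
  exact hne fun w => congrFun this w

/-- Division of entire functions. -/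
lemma exists_entire_mul_eq {A B : ℂ → ℂ} (hA : Differentiable ℂ A) (hB : Differentiable ℂ B)
    (hfin : ∀ z, analyticOrderAt B z ≠ ⊤) (hle : ∀ z, analyticOrderAt B z ≤ analyticOrderAt A z) :
    ∃ Q : ℂ → ℂ, Differentiable ℂ Q ∧ ∀ z, Q z * B z = A z := by
  have hloc : ∀ z, ∃ q : ℂ → ℂ, AnalyticAt ℂ q z ∧ ∀ᶠ w in 𝓝 z, q w * B w = A w := by
    intro z
    obtain ⟨b, hb, hb0, hBb⟩ := ((hB.analyticAt z).analyticOrderAt_ne_top).1 (hfin z)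
    have h1 := hle z
    rw [← Nat.cast_analyticOrderNatAt (hfin z)] at h1
    obtain ⟨a, ha, hAa⟩ := (natCast_le_analyticOrderAt (hA.analyticAt z)).1 h1
    refine ⟨fun w => a w / b w, ha.fun_div hb hb0, ?_⟩
    filter_upwards [hBb, hAa, hb.continuousAt.eventually_ne hb0] with w e1 e2 e3
    rw [e1, e2]
    simp only [smul_eq_mul]
    field_simp
  choose q hq hqe using hloc
  refine ⟨fun z => q z z, fun z => ?_, fun z => (hqe z).self_of_nhds⟩
  refine (hq z).differentiableAt.congr_of_eventuallyEq ?_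
  have hBne : ∀ᶠ w in 𝓝 z, w ≠ z → B w ≠ 0 := by
    rcases (hB.analyticAt z).eventually_eq_zero_or_eventually_ne_zero with h | h
    · exact absurd (analyticOrderAt_eq_top.2 h) (hfin z)
    · exact eventually_nhdsWithin_iff.1 h
  filter_upwards [hqe z, hBne] with w h1 h2
  rcases eq_or_ne w z with rfl | hw
  · rfl
  · exact mul_right_cancel₀ (h2 hw) ((hqe w).self_of_nhds.trans h1.symm)

lemma differentiable_iteratedDeriv_of_entire {F : ℂ → ℂ} (hF : Differentiable ℂ F) (j : ℕ) :
    Differentiable ℂ (iteratedDeriv j F) :=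
  (hF.contDiff (n := ⊤)).differentiable_iteratedDeriv j (by exact_mod_cast WithTop.coe_lt_top _)

/-- Existence of the auxiliary functions. -/
lemma exists_isAux {k : ℕ} {F : ℂ → ℂ} (hF : Differentiable ℂ F) (hk : 1 ≤ k)
    (hF' : ¬ ∀ z, deriv F z = 0) (hord : ∀ z, F z = 0 → (k + 2 : ℕ) ≤ analyticOrderAt F z)
    (hshare : ∀ z, F z = 1 → iteratedDeriv k F z = 1) : ∃ φ D, IsAux k F φ D := by
  have ha := hF.analyticAt
  have hGd := differentiable_iteratedDeriv_of_entire hF k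
  have hdfin := analyticOrderAt_ne_top_of_entire hF.deriv hF'
  have hsub : ∀ c z, F z = c → analyticOrderAt (fun w => F w - c) z ≠ ⊤ := by
    rintro c z rfl
    rw [← (ha z).analyticOrderAt_deriv_add_one]
    exact WithTop.add_ne_top.2 ⟨hdfin z, ENat.one_ne_top⟩
  have hFfin : ∀ z, analyticOrderAt F z ≠ ⊤ := analyticOrderAt_ne_top_of_entire hF (by
    intro h
    refine hF' fun z => ?_
    rw [show F = fun _ => 0 from funext h]
    simp)
  have hF1fin : ∀ z, analyticOrderAt (fun w => F w - 1) z ≠ ⊤ :=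
    analyticOrderAt_ne_top_of_entire (hF.sub_const 1) (by
      intro h
      refine hF' fun z => ?_
      rw [show F = fun _ => 1 from funext fun w => sub_eq_zero.1 (h w)]
      simp)
  have ha1 : ∀ z, AnalyticAt ℂ (fun w => F w - 1) z := (hF.sub_const 1).analyticAt
  have hprod : ∀ z, analyticOrderAt (F * fun w => F w - 1) z =
      analyticOrderAt F z + analyticOrderAt (fun w => F w - 1) z := fun z =>
    analyticOrderAt_mul (ha z) (ha1 z)
  have hprod' : ∀ z, analyticOrderAt (deriv F * (F - iteratedDeriv k F)) z =
      analyticOrderAt (deriv F) z + analyticOrderAt (F - iteratedDeriv k F) z := fun z =>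
    analyticOrderAt_mul (hF.deriv.analyticAt z) ((hF.sub hGd).analyticAt z)
  have hzero : ∀ z, F z = 0 → ∃ p : ℕ, k + 2 ≤ p ∧ analyticOrderAt F z = p ∧
      analyticOrderAt (fun w => F w - 1) z = 0 ∧ analyticOrderAt (deriv F) z + 1 = p ∧
      ((p - k : ℕ) : ℕ∞) ≤ analyticOrderAt (F - iteratedDeriv k F) z := by
    intro z hz
    obtain ⟨p, hp⟩ := WithTop.ne_top_iff_exists.1 (hFfin z)
    have hp' : analyticOrderAt F z = (p : ℕ∞) := hp.symm
    have hpk := hord z hz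
    rw [hp'] at hpk
    have hpk' : k + 2 ≤ p := by exact_mod_cast hpk
    refine ⟨p, hpk', hp', ?_, ?_, ?_⟩
    · rw [(ha1 z).analyticOrderAt_eq_zero, hz]; simp
    · rw [(ha z).analyticOrderAt_deriv_add_one, ← hp', hz]
      simp
    · refine le_trans ?_ le_analyticOrderAt_sub
      rw [iteratedDeriv_eq_iterate, analyticOrderAt_iterated_deriv (ha z) hp'.symm (by omega)
        (by omega), hp']
      exact le_min (by exact_mod_cast Nat.sub_le p k) le_rfl
  obtain ⟨φ, hφ, hφe⟩ := exists_entire_mul_eq (A := deriv F * (F - iteratedDeriv k F))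
    (B := F * fun w => F w - 1) (hF.deriv.mul (hF.sub hGd)) (hF.mul (hF.sub_const 1))
    (fun z => by rw [hprod]; exact WithTop.add_ne_top.2 ⟨hFfin z, hF1fin z⟩) (fun z => by
      rw [hprod, hprod']
      by_cases hz : F z = 0
      · obtain ⟨p, hp, e1, e2, e3, e4⟩ := hzero z hz
        rw [e1, e2, add_zero]
        have : (1 : ℕ∞) ≤ ((p - k : ℕ) : ℕ∞) := by
          exact_mod_cast (by omega : 1 ≤ p - k)
        rw [← e3]
        exact add_le_add le_rfl (this.trans e4)
      · rw [(ha z).analyticOrderAt_eq_zero.2 hz, zero_add]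
        by_cases hz1 : F z = 1
        · have e := (ha z).analyticOrderAt_deriv_add_one
          rw [hz1] at e
          rw [← e]
          refine add_le_add le_rfl (Order.one_le_iff_ne_zero.2 ?_)
          rw [((hF.sub hGd).analyticAt z).analyticOrderAt_ne_zero]
          simp [hz1, hshare z hz1]
        · rw [(ha1 z).analyticOrderAt_eq_zero.2 (sub_ne_zero.2 hz1)]
          exact zero_le)
  have hφe' : φ * (F * fun w => F w - 1) = deriv F * (F - iteratedDeriv k F) := funext hφe
  obtain ⟨D, hD, hDe⟩ := exists_entire_mul_eq (A := φ ^ (k + 2)) (B := F) (hφ.pow _) hF hFfin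
    (fun z => by
      by_cases hz : F z = 0
      · obtain ⟨p, hp, e1, e2, e3, e4⟩ := hzero z hz
        have e : analyticOrderAt (φ * (F * fun w => F w - 1)) z =
          analyticOrderAt (deriv F * (F - iteratedDeriv k F)) z := by rw [hφe']
        rw [analyticOrderAt_mul (hφ.analyticAt z) ((hF.mul (hF.sub_const 1)).analyticAt z), hprod,
          hprod', e1, e2, add_zero] at e
        rw [analyticOrderAt_pow (hφ.analyticAt z), e1]
        by_cases htop : analyticOrderAt φ z = ⊤
        · rw [htop, nsmul_eq_mul, ENat.mul_top (by simp)]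
          exact le_top
        · obtain ⟨a, ha⟩ := WithTop.ne_top_iff_exists.1 htop
          have ha' : analyticOrderAt φ z = (a : ℕ∞) := ha.symm
          have e5 : ((p + (p - k) : ℕ) : ℕ∞) ≤ ((a + p + 1 : ℕ) : ℕ∞) := by
            push_cast
            rw [← ha', e, add_right_comm, e3]
            exact add_le_add le_rfl (by exact_mod_cast e4)
          have e6 : p + (p - k) ≤ a + p + 1 := by exact_mod_cast e5
          rw [ha', nsmul_eq_mul]
          have e7 : p ≤ (k + 2) * a := by
            obtain ⟨t, rfl⟩ := Nat.exists_eq_add_of_le hp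
            have : t + 1 ≤ a := by omega
            nlinarith
          exact_mod_cast e7
      · rw [(ha z).analyticOrderAt_eq_zero.2 hz]
        exact zero_le)
  exact ⟨φ, D, hF, hφ, hD, hφe, hDe⟩

lemma iteratedDeriv_polynomial_eval (p : Polynomial ℂ) (k : ℕ) :
    iteratedDeriv k (fun z => p.eval z) = fun z => (Polynomial.derivative^[k] p).eval z := by
  induction k with
  | zero => simp
  | succ k ih =>
    rw [iteratedDeriv_succ, ih, Function.iterate_succ_apply']
    funext z
    exact Polynomial.deriv _

lemma IsAux.eq_zero_of_polynomial {k : ℕ} {F φ D : ℂ → ℂ} (h : IsAux k F φ D)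
    (hF' : ¬ ∀ z, deriv F z = 0) (hp : ∃ p : Polynomial ℂ, ∀ z, F z = p.eval z) (z : ℂ) :
    φ z = 0 := by
  obtain ⟨p, hp⟩ := hp
  obtain rfl : F = fun z => p.eval z := funext hp
  have hdeg : p.natDegree ≠ 0 := by
    intro h0
    obtain ⟨c, rfl⟩ := Polynomial.natDegree_eq_zero.1 h0
    exact hF' fun z => by simp
  have hp0 : p ≠ 0 := by rintro rfl; simp at hdeg
  have hd1 : (p - 1).natDegree = p.natDegree := by
    rw [← Polynomial.C_1, Polynomial.natDegree_sub_C]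
  have hp1 : p - 1 ≠ 0 := by intro h0; rw [h0] at hd1; simp at hd1; omega
  have he : ∀ z, φ z * (p * (p - 1)).eval z =
      (Polynomial.derivative p * (p - Polynomial.derivative^[k] p)).eval z := by
    intro z
    have e := h.phi_eq z
    rw [iteratedDeriv_polynomial_eval, Polynomial.deriv] at e
    simpa using e
  obtain ⟨q, hq⟩ := exists_polynomial_of_mul h.diff_phi.continuous _ (p * (p - 1)) _
    (mul_ne_zero hp0 hp1) rfl he
  have he2 : q * (p * (p - 1)) = Polynomial.derivative p * (p - Polynomial.derivative^[k] p) :=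
    Polynomial.funext fun z => by rw [Polynomial.eval_mul, ← hq, he]
  have hq0 : q = 0 := by
    by_contra hq0
    have e := congrArg Polynomial.natDegree he2
    rw [Polynomial.natDegree_mul hq0 (mul_ne_zero hp0 hp1), Polynomial.natDegree_mul hp0 hp1,
      hd1] at e
    have e1 := Polynomial.natDegree_mul_le (p := Polynomial.derivative p)
      (q := p - Polynomial.derivative^[k] p)
    have e2 := Polynomial.natDegree_derivative_lt hdeg
    have e3 := Polynomial.natDegree_sub_le p (Polynomial.derivative^[k] p)
    have e4 := Polynomial.natDegree_iterate_derivative p k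
    rw [max_eq_left (by omega)] at e3
    omega
  rw [hq, hq0, Polynomial.eval_zero]

lemma IsAux.comp_add_const {k : ℕ} {F φ D : ℂ → ℂ} (h : IsAux k F φ D) (a : ℂ) :
    IsAux k (fun z => F (z + a)) (fun z => φ (z + a)) (fun z => D (z + a)) where
  diff := h.diff.comp (differentiable_id.add_const a)
  diff_phi := h.diff_phi.comp (differentiable_id.add_const a)
  diff_D := h.diff_D.comp (differentiable_id.add_const a)
  phi_eq z := by
    rw [iteratedDeriv_comp_add_const, deriv_comp_add_const]
    exact h.phi_eq (z + a)
  D_eq z := h.D_eq (z + a)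

lemma eventually_ne_zero_of_entire {g : ℂ → ℂ} (hg : Differentiable ℂ g)
    (hne : ¬ ∀ z, g z = 0) (z : ℂ) : ∀ᶠ w in 𝓝[≠] z, g w ≠ 0 := by
  rcases (hg.analyticAt z).eventually_eq_zero_or_eventually_ne_zero with h | h
  · exact absurd (analyticOrderAt_eq_top.2 h) (analyticOrderAt_ne_top_of_entire hg hne z)
  · exact h

lemma IsAux.eq_zero {k : ℕ} {F φ D : ℂ → ℂ} (h : IsAux k F φ D) (hk : 1 ≤ k)
    (hF' : ¬ ∀ z, deriv F z = 0) (z : ℂ) : φ z = 0 := by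
  by_cases hp : ∃ p : Polynomial ℂ, ∀ z, F z = p.eval z
  · exact h.eq_zero_of_polynomial hF' hp z
  by_contra hz
  have hder : ∀ j, ¬ ∀ z, iteratedDeriv j F z = 0 := by
    intro j hj
    refine hp (exists_polynomial_of_iteratedDeriv_eq_zero h.diff (N := j) fun n hn => ?_)
    obtain ⟨m, rfl⟩ := Nat.exists_eq_add_of_lt hn
    have hj' : deriv^[j] F = fun _ => 0 := by
      rw [← iteratedDeriv_eq_iterate]; exact funext hj
    have hconst : ∀ i, deriv^[i] (fun _ : ℂ => (0 : ℂ)) = fun _ => 0 := by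
      intro i
      induction i with
      | zero => rfl
      | succ i ih => rw [Function.iterate_succ_apply', ih]; simp
    rw [iteratedDeriv_eq_iterate, show j + m + 1 = (m + 1) + j by ring, Function.iterate_add_apply,
      hj', hconst]
  have e1 := eventually_ne_zero_of_entire h.diff_phi (fun hall => hz (hall z)) 0
  have e2 := eventually_ne_zero_of_entire (h.diff.sub_const 1) (fun hall => hF' fun z => by
    rw [show F = fun _ => 1 from funext fun w => sub_eq_zero.1 (hall w)]
    simp) 0
  have e3 : ∀ᶠ w in 𝓝[≠] (0 : ℂ), ∀ j ∈ Finset.range k, iteratedDeriv j F w ≠ 0 :=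
    (Filter.eventually_all_finset _).2 fun j _ =>
      eventually_ne_zero_of_entire (differentiable_iteratedDeriv_of_entire h.diff j) (hder j) 0
  obtain ⟨a, ha1, ha2, ha3⟩ := (e1.and (e2.and e3)).exists
  obtain ⟨p, hp'⟩ := (h.comp_add_const a).exists_polynomial hk
    (by rw [zero_add]; exact sub_ne_zero.1 ha2)
    (fun j hj => by
      rw [iteratedDeriv_comp_add_const]
      simpa using ha3 j (Finset.mem_range.2 hj))
    (by
      intro h0
      have := h.D_eq a
      rw [zero_add] at h0
      rw [h0, zero_mul] at this
      exact ha1 (pow_eq_zero_iff (by omega) |>.1 this.symm))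
  refine hp ⟨p.comp (Polynomial.X - Polynomial.C a), fun z => ?_⟩
  have := hp' (z - a)
  simpa using this

/-- Under the multiplicity and sharing hypotheses, `F` solves the differential equation. -/
lemma iteratedDeriv_eq_self {k : ℕ} {F : ℂ → ℂ} (hF : Differentiable ℂ F) (hk : 1 ≤ k)
    (hF' : ¬ ∀ z, deriv F z = 0) (hord : ∀ z, F z = 0 → (k + 2 : ℕ) ≤ analyticOrderAt F z)
    (hshare : ∀ z, F z = 1 → iteratedDeriv k F z = 1) (z : ℂ) : iteratedDeriv k F z = F z := by
  obtain ⟨φ, D, h⟩ := exists_isAux hF hk hF' hord hshare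
  have hmul : ∀ z ∈ univ, deriv F z * (F z - iteratedDeriv k F z) = 0 := fun z _ => by
    rw [← h.phi_eq, h.eq_zero hk hF', zero_mul]
  rcases AnalyticOnNhd.eq_zero_or_eq_zero_of_mul_eq_zero (fun z _ => hF.deriv.analyticAt z)
    (fun z _ => (hF.sub (differentiable_iteratedDeriv_of_entire hF k)).analyticAt z) hmul
    isPreconnected_univ with h1 | h1
  · exact absurd (fun z => h1 z (mem_univ z)) hF'
  · exact (sub_eq_zero.1 (h1 z (mem_univ z))).symm

/-- An entire solution of `F⁽ᵏ⁾ = F` has derivatives periodic in the order. -/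
lemma iteratedDeriv_add_eq {k : ℕ} {F : ℂ → ℂ} (h : ∀ z, iteratedDeriv k F z = F z) (j : ℕ) :
    iteratedDeriv (j + k) F = iteratedDeriv j F := by
  have h' : deriv^[k] F = F := by rw [← iteratedDeriv_eq_iterate]; exact funext h
  rw [iteratedDeriv_eq_iterate, iteratedDeriv_eq_iterate, Function.iterate_add_apply, h']

lemma ne_zero_of_iteratedDeriv_eq {k : ℕ} {F : ℂ → ℂ} (hF : Differentiable ℂ F) (hk : 1 ≤ k)
    (hF0 : ¬ ∀ z, F z = 0) (hord : ∀ z, F z = 0 → (k + 2 : ℕ) ≤ analyticOrderAt F z)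
    (h : ∀ z, iteratedDeriv k F z = F z) (z : ℂ) : F z ≠ 0 := by
  intro hz
  have h0 := (natCast_le_analyticOrderAt_iff_iteratedDeriv_eq_zero (hF.analyticAt z)).1 (hord z hz)
  have hall : ∀ j, iteratedDeriv j F z = 0 := by
    intro j
    induction j using Nat.strong_induction_on with
    | _ j ih =>
      by_cases hj : j < k + 2
      · exact h0 j hj
      · obtain ⟨i, rfl⟩ := Nat.exists_eq_add_of_le (show k ≤ j by omega)
        rw [add_comm, iteratedDeriv_add_eq h]
        exact ih i (by omega)
  refine hF0 fun w => ?_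
  rw [← Complex.taylorSeries_eq_of_entire' z w hF]
  simp [hall]

lemma norm_le_mul_exp_of_iteratedDeriv_eq {k : ℕ} {F : ℂ → ℂ} (hF : Differentiable ℂ F)
    (hk : 1 ≤ k) (h : ∀ z, iteratedDeriv k F z = F z) :
    ∃ C : ℝ, 0 < C ∧ ∀ z, ‖F z‖ ≤ C * Real.exp ‖z‖ := by
  set C : ℝ := 1 + ∑ j ∈ Finset.range k, ‖iteratedDeriv j F 0‖ with hC
  have hb : ∀ j, ‖iteratedDeriv j F 0‖ ≤ C := by
    intro j
    induction j using Nat.strong_induction_on with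
    | _ j ih =>
      by_cases hj : j < k
      · have := Finset.single_le_sum (f := fun j => ‖iteratedDeriv j F 0‖)
          (fun i _ => norm_nonneg _) (Finset.mem_range.2 hj)
        exact this.trans (by rw [hC]; linarith)
      · obtain ⟨i, rfl⟩ := Nat.exists_eq_add_of_le (show k ≤ j by omega)
        rw [add_comm, iteratedDeriv_add_eq h]
        exact ih i (by omega)
  refine ⟨C, by positivity, fun z => ?_⟩
  have hs := Complex.hasSum_taylorSeries_of_entire hF 0 z
  have he : HasSum (fun n : ℕ => C * (‖z‖ ^ n / n.factorial)) (C * Real.exp ‖z‖) := by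
    have := NormedSpace.expSeries_div_hasSum_exp (𝔸 := ℝ) ‖z‖
    rw [← Real.exp_eq_exp_ℝ] at this
    exact this.mul_left C
  rw [← hs.tsum_eq, ← he.tsum_eq]
  refine tsum_of_norm_bounded he.summable.hasSum fun n => ?_
  rw [sub_zero, norm_smul, norm_smul, norm_inv, norm_pow, Complex.norm_natCast]
  calc _ ≤ ((n.factorial : ℝ))⁻¹ * (‖z‖ ^ n * C) := by gcongr; exact hb n
    _ = _ := by ring

/-- An entire function whose real part grows at most linearly is affine. -/
lemma eq_affine_of_re_le {G : ℂ → ℂ} (hG : Differentiable ℂ G) {A : ℝ}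
    (h : ∀ z, (G z).re ≤ ‖z‖ + A) (z : ℂ) : G z = G 0 + deriv G 0 * z := by
  have hgr : ∀ r₀ : ℝ, ∃ r ≥ r₀, ∀ z, ‖z‖ ≤ r →
      ‖G z‖ ≤ (‖G 0‖ + 2 * (2 + |A| + ‖G 0‖)) * r ^ 1 := fun r₀ => by
      refine ⟨max r₀ 1, le_max_left _ _, fun z hz => ?_⟩
      set r := max r₀ 1 with hr
      have hr1 : 1 ≤ r := le_max_right _ _
      have hM : 0 < 2 * r + |A| + ‖G 0‖ := by positivity
      have hb := Complex.borelCaratheodory_zero (f := fun z => G z - G 0) (R := 2 * r) (z := z) hM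
        (hG.sub_const _).differentiableOn (fun w hw => by
          have e1 := h w
          have e2 := (abs_le.1 (Complex.abs_re_le_norm (G 0))).1
          have e3 := le_abs_self A
          have e4 := mem_ball_zero_iff.1 hw
          simp only [Set.mem_ofPred_eq, Complex.sub_re]
          linarith) (by linarith) (by simp; linarith) (by simp)
      have e : 2 * (2 * r + |A| + ‖G 0‖) * ‖z‖ / (2 * r - ‖z‖) ≤ 2 * (2 * r + |A| + ‖G 0‖) := by
        rw [div_le_iff₀ (by linarith)]
        gcongr
        linarith
      have e2 : ‖G z‖ ≤ ‖G 0‖ + ‖G z - G 0‖ := by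
        simpa using norm_add_le (G 0) (G z - G 0)
      have e3 : |A| + ‖G 0‖ ≤ (|A| + ‖G 0‖) * r := le_mul_of_one_le_right (by positivity) hr1
      have e4 : ‖G 0‖ ≤ ‖G 0‖ * r := le_mul_of_one_le_right (by positivity) hr1
      rw [pow_one]
      linarith
  rw [← Complex.taylorSeries_eq_of_entire' 0 z hG, tsum_eq_sum (s := Finset.range 2)]
  · simp [Finset.sum_range_succ]
  · intro n hn
    rw [iteratedDeriv_eq_zero_of_growth hG hgr (by simpa using hn)]
    simp

end

/-- Zhang–Yang (paper's Theorem 2.F): if `n ≥ k + 2` and `f^n`, `(f^n)^(k)`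
share `1` IM, then `f^n ≡ (f^n)^(k)`, i.e. `f(z) = c e^{(λ/n) z}` with
`λ^k = 1`. -/
theorem zhang_yang_IM
    (f : ℂ → ℂ) (hf : Differentiable ℂ f) (hnc : ¬∃ c : ℂ, ∀ z, f z = c)
    (k n : ℕ) (hk : 1 ≤ k) (hn : k + 2 ≤ n)
    (hshare : ∀ z, f z ^ n = 1 ↔ iteratedDeriv k (fun w => f w ^ n) z = 1) :
    (∀ z, iteratedDeriv k (fun w => f w ^ n) z = f z ^ n) ∧
    ∃ c l : ℂ, c ≠ 0 ∧ l ≠ 0 ∧ l ^ k = 1 ∧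
      ∀ z, f z = c * Complex.exp (l / (n : ℂ) * z) := by
  have hF : Differentiable ℂ fun w => f w ^ n := hf.pow n
  have hn0 : (n : ℂ) ≠ 0 := by exact_mod_cast (by omega : n ≠ 0)
  have hf0 : ¬ ∀ z, f z = 0 := fun h => hnc ⟨0, h⟩
  have hf' : ¬ ∀ z, deriv f z = 0 := fun h =>
    hnc ⟨f 0, fun z => is_const_of_deriv_eq_zero hf h z 0⟩
  have hF0 : ¬ ∀ z, f z ^ n = 0 := fun h => hf0 fun z => pow_eq_zero_iff (by omega) |>.1 (h z)
  have hF' : ¬ ∀ z, deriv (fun w => f w ^ n) z = 0 := by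
    intro h
    have hmul : ∀ z ∈ Set.univ, f z ^ (n - 1) * deriv f z = 0 := fun z _ => by
      have e := h z
      rw [deriv_fun_pow (hf z), mul_assoc, mul_eq_zero] at e
      exact e.resolve_left hn0
    rcases AnalyticOnNhd.eq_zero_or_eq_zero_of_mul_eq_zero
      (fun z _ => (hf.pow (n - 1)).analyticAt z) (fun z _ => hf.deriv.analyticAt z) hmul
      isPreconnected_univ with h1 | h1
    · exact hf0 fun z => pow_eq_zero_iff (by omega) |>.1 (h1 z (Set.mem_univ z))
    · exact hf' fun z => h1 z (Set.mem_univ z)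
  have hord : ∀ z, f z ^ n = 0 → (k + 2 : ℕ) ≤ analyticOrderAt (fun w => f w ^ n) z := by
    intro z hz
    have hz' : f z = 0 := pow_eq_zero_iff (by omega) |>.1 hz
    have e := analyticOrderAt_pow (hf.analyticAt z) n
    change _ ≤ analyticOrderAt (f ^ n) z
    rw [e, nsmul_eq_mul]
    have h1 : 1 ≤ analyticOrderAt f z :=
      Order.one_le_iff_ne_zero.2 ((hf.analyticAt z).analyticOrderAt_ne_zero.2 hz')
    calc ((k + 2 : ℕ) : ℕ∞) ≤ (n : ℕ∞) := by exact_mod_cast hn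
      _ = n * 1 := (mul_one _).symm
      _ ≤ _ := by gcongr
  have heq : ∀ z, iteratedDeriv k (fun w => f w ^ n) z = f z ^ n :=
    iteratedDeriv_eq_self hF hk hF' hord fun z => (hshare z).1
  refine ⟨heq, ?_⟩
  have hne : ∀ z, f z ≠ 0 := fun z hz => ne_zero_of_iteratedDeriv_eq hF hk hF0 hord heq z (by
    simp only [hz]; exact zero_pow (by omega))
  obtain ⟨C, hC, hgr⟩ := norm_le_mul_exp_of_iteratedDeriv_eq hF hk heq
  obtain ⟨G, hG⟩ := exists_hasDerivAt_exp_eq hf isOpen_univ isPreconnected_univ (Set.mem_univ 0)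
    (fun z _ => hne z) (Differentiable.isExactOn_univ (hf.deriv.fun_div hf hne))
  have hGd : Differentiable ℂ G := fun z => (hG z (Set.mem_univ z)).1.differentiableAt
  have hfG : ∀ z, f z = Complex.exp (G z) := fun z => (hG z (Set.mem_univ z)).2
  have hre : ∀ z, (G z).re ≤ ‖z‖ + |Real.log C| := by
    intro z
    have e := hgr z
    rw [hfG z, norm_pow, Complex.norm_exp, ← Real.exp_nat_mul] at e
    nth_rewrite 1 [← Real.exp_log hC] at e
    rw [← Real.exp_add, Real.exp_le_exp] at e
    have h1 : (1 : ℝ) ≤ n := by exact_mod_cast (by omega : 1 ≤ n)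
    have h2 := le_abs_self (Real.log C)
    have h3 := abs_nonneg (Real.log C)
    have h4 := norm_nonneg z
    by_contra! hcon
    nlinarith
  have haff := eq_affine_of_re_le hGd hre
  set c := deriv G 0 with hc
  have hFe : (fun w => f w ^ n) = fun w => Complex.exp (n * G 0) * Complex.exp (n * c * w) := by
    funext w
    rw [hfG w, haff w, ← Complex.exp_nat_mul, ← Complex.exp_add]
    ring_nf
  have hpow : (n * c) ^ k = 1 := by
    have e := heq 0
    rw [hFe, show f 0 ^ n = _ from congrFun hFe 0] at e
    rw [iteratedDeriv_const_mul_field, iteratedDeriv_cexp_const_mul] at e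
    simpa using e
  refine ⟨Complex.exp (G 0), n * c, Complex.exp_ne_zero _, ?_, hpow, fun z => ?_⟩
  · intro h0
    rw [h0, zero_pow (by omega)] at hpow
    exact zero_ne_one hpow
  · rw [hfG z, haff z, Complex.exp_add, mul_div_cancel_left₀ _ hn0]
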